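/- arXiv:2601.16974 — 5 statements merged into one kernel-verified Lean document; each statement's English description precedes it below -/
import Mathlib

section
/- Infinite p-number for Pauli-diagonal generators with a maximally mixed initial state: Let the system consist of n_S qubits (d_S = 2^{n_S}) and the environment of n_E qubits (d_E = 2^{n_E}), and index the eigenvectors of the generator by Pauli strings A ⊗ B, where A is an n_E-qubit Pauli string and B is an n_S-qubit Pauli string. Let ρ₀ = 𝟙/(d_S d_E) be the maximally mixed state. Then for every N ≥ 1, every string of jump labels ν_i = (μ_i, μ_i') (each μ_i, μ_i' labelling an n_S-qubit Pauli string), and every string of eigenvector labels (A_1 ⊗ B_1, …, A_N ⊗ B_N), the coefficient c^{(N)} = Tr[(𝟙_E ⊗ P_{μ_N})(A_N ⊗ B_N)(𝟙_E ⊗ P_{μ_N'})†] · ∏_{i=2}^{N} Tr[(A_i ⊗ B_i)† (𝟙_E ⊗ P_{μ_{i−1}})(A_{i−1} ⊗ B_{i−1})(𝟙_E ⊗ P_{μ_{i−1}'})†] · Tr[(A_1 ⊗ B_1)† ρ₀] vanishes whenever some A_i is not the identity Pauli string on the environment. Consequently, any generator that is diagonal in the Pauli basis, together with the maximally mixed initial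 state, yields a process whose p-number is infinite. -/
/-!
Infinite p-number for Pauli-diagonal generators with a maximally mixed initial state.
-/

noncomputable section
open Matrix Finset

/-- The four single-qubit Pauli matrices `𝟙, σ_x, σ_y, σ_z`. -/
def pauli : Fin 4 → Matrix (Fin 2) (Fin 2) ℂ :=
  ![1, !![0, 1; 1, 0], !![0, -Complex.I; Complex.I, 0], !![1, 0; 0, -1]]

/-- An `n`-qubit Pauli string: the tensor product of the Pauli matrices labelled by `A`. -/
def pauliString {n : ℕ} (A : Fin n → Fin 4) :
    Matrix (Fin n → Fin 2) (Fin n → Fin 2) ℂ :=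
  Matrix.of fun f g => ∏ i : Fin n, pauli (A i) (f i) (g i)

/-- The Kronecker (tensor) product of an environment matrix and a system matrix, on the index
set `environment × system`. -/
def kron {α β : Type*} (M : Matrix α α ℂ) (N : Matrix β β ℂ) :
    Matrix (α × β) (α × β) ℂ :=
  Matrix.of fun p q => M p.1 q.1 * N p.2 q.2

/-- The eigenvector `A ⊗ B` of a Pauli-diagonal generator: an environment Pauli string
tensored with a system Pauli string. -/
def eigvec {nE nS : ℕ} (A : Fin nE → Fin 4) (B : Fin nS → Fin 4) :
    Matrix ((Fin nE → Fin 2) × (Fin nS → Fin 2)) ((Fin nE → Fin 2) × (Fin nS → Fin 2)) ℂ :=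
  kron (pauliString A) (pauliString B)

/-- The jump operator `𝟙_E ⊗ P_μ`: a system Pauli string acting on the system factor only. -/
def sysPauli {nE nS : ℕ} (μ : Fin nS → Fin 4) :
    Matrix ((Fin nE → Fin 2) × (Fin nS → Fin 2)) ((Fin nE → Fin 2) × (Fin nS → Fin 2)) ℂ :=
  kron (1 : Matrix (Fin nE → Fin 2) (Fin nE → Fin 2) ℂ) (pauliString μ)

/-- The maximally mixed state `ρ₀ = 𝟙 / (d_S d_E)` on `n_E + n_S` qubits. -/
def maxMixed (nE nS : ℕ) :
    Matrix ((Fin nE → Fin 2) × (Fin nS → Fin 2)) ((Fin nE → Fin 2) × (Fin nS → Fin 2)) ℂ :=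
  ((2 ^ nS * 2 ^ nE : ℂ))⁻¹ •
    (1 : Matrix ((Fin nE → Fin 2) × (Fin nS → Fin 2)) ((Fin nE → Fin 2) × (Fin nS → Fin 2)) ℂ)

open scoped Kronecker

lemma kron_eq_kronecker {α β : Type*} (M : Matrix α α ℂ) (N : Matrix β β ℂ) :
    kron M N = M ⊗ₖ N := rfl

/-- The Hilbert-Schmidt inner product of Pauli strings factors over the qubits. -/
lemma trace_conjTranspose_pauliString_mul {n : ℕ} (A A' : Fin n → Fin 4) :
    ((pauliString A)ᴴ * pauliString A').trace =
      ∏ i, ((pauli (A i))ᴴ * pauli (A' i)).trace := by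
  simp only [Matrix.trace, Matrix.diag_apply, Matrix.mul_apply, Matrix.conjTranspose_apply,
    pauliString, Matrix.of_apply, star_prod, ← Finset.prod_mul_distrib]
  simp only [Finset.prod_univ_sum, Fintype.piFinset_univ]

lemma trace_conjTranspose_pauli_mul_of_ne {a b : Fin 4} (h : a ≠ b) :
    ((pauli a)ᴴ * pauli b).trace = 0 := by
  fin_cases a <;> fin_cases b <;>
    simp [pauli, Matrix.trace, Matrix.mul_apply, Fin.sum_univ_two] at h ⊢

/-- Distinct Pauli strings are trace-orthogonal. -/
lemma trace_conjTranspose_pauliString_mul_of_ne {n : ℕ} {A A' : Fin n → Fin 4} (h : A ≠ A') :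
    ((pauliString A)ᴴ * pauliString A').trace = 0 := by
  obtain ⟨i, hi⟩ := Function.ne_iff.mp h
  rw [trace_conjTranspose_pauliString_mul]
  exact Finset.prod_eq_zero (Finset.mem_univ i) (trace_conjTranspose_pauli_mul_of_ne hi)

lemma pauliString_zero {n : ℕ} : pauliString (fun _ : Fin n => (0 : Fin 4)) = 1 := by
  ext f g
  simp [pauliString, pauli, Matrix.one_apply, Finset.prod_ite_zero, funext_iff]

/-- Jumps on the system factor do not connect eigenvectors with different environment labels. -/
lemma trace_eigvec_jump_of_ne {nE nS : ℕ} {A A' : Fin nE → Fin 4} (h : A' ≠ A)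
    (B B' μ μ' : Fin nS → Fin 4) :
    ((eigvec A' B')ᴴ * sysPauli (nE := nE) μ * eigvec A B *
      (sysPauli (nE := nE) μ')ᴴ).trace = 0 := by
  simp only [eigvec, sysPauli, kron_eq_kronecker, Matrix.conjTranspose_kronecker,
    ← Matrix.mul_kronecker_mul, Matrix.trace_kronecker, Matrix.conjTranspose_one, mul_one,
    trace_conjTranspose_pauliString_mul_of_ne h, zero_mul]

/-- The maximally mixed state overlaps only with eigenvectors trivial on the environment. -/
lemma trace_eigvec_maxMixed_of_ne {nE nS : ℕ} {A : Fin nE → Fin 4} (h : A ≠ fun _ => 0)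
    (B : Fin nS → Fin 4) : ((eigvec A B)ᴴ * maxMixed nE nS).trace = 0 := by
  have hA := trace_conjTranspose_pauliString_mul_of_ne h
  rw [pauliString_zero, mul_one] at hA
  simp only [eigvec, maxMixed, kron_eq_kronecker, Matrix.conjTranspose_kronecker,
    Matrix.mul_smul, mul_one, Matrix.trace_smul, Matrix.trace_kronecker, hA, zero_mul, smul_zero]

/-- **Infinite p-number for Pauli-diagonal generators with a maximally mixed initial state.**
For a system of `n_S` qubits and an environment of `n_E` qubits, eigenvectors indexed by
Pauli strings `A ⊗ B`, jump labels `(μ, μ')`, and the maximally mixed initial state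
`ρ₀ = 𝟙/(d_S d_E)`, the multi-time coefficient
`c^{(N)} = Tr[(𝟙_E ⊗ P_{μ_N})(A_N ⊗ B_N)(𝟙_E ⊗ P_{μ_N'})†]
  · ∏_{i=2}^N Tr[(A_i ⊗ B_i)† (𝟙_E ⊗ P_{μ_{i−1}})(A_{i−1} ⊗ B_{i−1})(𝟙_E ⊗ P_{μ_{i−1}'})†]
  · Tr[(A_1 ⊗ B_1)† ρ₀]`
vanishes whenever some `A_i` is not the identity Pauli string on the environment.
Strings have length `N + 1 ≥ 1` and are `0`-indexed: cell `i` carries the data with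
one-based index `i + 1`.  Consequently any Pauli-diagonal generator together with the
maximally mixed initial state yields a process with infinite p-number. -/
theorem pauliDiagonal_coefficient_vanishes (nS nE : ℕ) (N : ℕ)
    (μ μ' : Fin (N + 1) → (Fin nS → Fin 4))
    (A : Fin (N + 1) → (Fin nE → Fin 4)) (B : Fin (N + 1) → (Fin nS → Fin 4))
    (i0 : Fin (N + 1)) (hA : A i0 ≠ fun _ => (0 : Fin 4)) :
    (sysPauli (nE := nE) (μ (Fin.last N)) * eigvec (A (Fin.last N)) (B (Fin.last N)) *
          (sysPauli (nE := nE) (μ' (Fin.last N)))ᴴ).trace *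
      (∏ i : Fin N,
        ((eigvec (A i.succ) (B i.succ))ᴴ * sysPauli (nE := nE) (μ i.castSucc) *
            eigvec (A i.castSucc) (B i.castSucc) *
            (sysPauli (nE := nE) (μ' i.castSucc))ᴴ).trace) *
      ((eigvec (A 0) (B 0))ᴴ * maxMixed nE nS).trace = 0 := by
  by_contra hne
  simp only [mul_eq_zero, not_or, Finset.prod_eq_zero_iff, Finset.mem_univ, true_and,
    not_exists] at hne
  obtain ⟨⟨-, hstep⟩, hinit⟩ := hne
  refine hA (Fin.induction (motive := fun i => A i = fun _ => 0) ?_ (fun i hi => ?_) i0)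
  · by_contra h
    exact hinit (trace_eigvec_maxMixed_of_ne h _)
  · by_contra h
    exact hstep i (trace_eigvec_jump_of_ne (fun e => h (e.trans hi)) _ _ _ _)
end
end

section
/- Positivity preservation of the transfer equation of motion: Let Q, R_1, …, R_m : [0, ∞) → M_D(ℂ) be continuous and let x : [0, ∞) → M_D(ℂ) be differentiable with dx/dt = Q(t) x(t) + x(t) Q(t)† + ∑_{ν=1}^m R_ν(t) x(t) R_ν(t)†. If x(0) is positive semidefinite, then x(t) is positive semidefinite for all t ≥ 0. -/
/-!
Positivity preservation of the transfer equation of motion.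
-/

noncomputable section
open Matrix Finset
open scoped ComplexOrder

namespace Matrix

variable {n ι : Type*} [Fintype n] [Fintype ι]

/-- The transfer generator `x ↦ Q x + x Q† + ∑ ν, R ν x (R ν)†`. -/
def transferGen (Q : Matrix n n ℂ) (R : ι → Matrix n n ℂ) (x : Matrix n n ℂ) : Matrix n n ℂ :=
  Q * x + x * Qᴴ + ∑ ν, R ν * x * (R ν)ᴴ

section transferGen

variable (Q : Matrix n n ℂ) (R : ι → Matrix n n ℂ)

lemma transferGen_add (x y : Matrix n n ℂ) :
    transferGen Q R (x + y) = transferGen Q R x + transferGen Q R y := by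
  simp only [transferGen, mul_add, add_mul, Finset.sum_add_distrib]
  abel

lemma transferGen_smul (c : ℂ) (x : Matrix n n ℂ) :
    transferGen Q R (c • x) = c • transferGen Q R x := by
  simp [transferGen, smul_add, Finset.smul_sum]

lemma transferGen_conjTranspose (x : Matrix n n ℂ) :
    transferGen Q R xᴴ = (transferGen Q R x)ᴴ := by
  simp only [transferGen, conjTranspose_add, conjTranspose_mul, conjTranspose_sum,
    conjTranspose_conjTranspose, Matrix.mul_assoc]
  abel

end transferGen

/-- The real part of the quadratic form of a complex matrix. -/
def reQuad (A : Matrix n n ℂ) (v : n → ℂ) : ℝ := (star v ⬝ᵥ A *ᵥ v).re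

lemma continuous_reQuad : Continuous fun p : Matrix n n ℂ × (n → ℂ) => reQuad p.1 p.2 :=
  Complex.continuous_re.comp <|
    (continuous_star.comp continuous_snd).dotProduct
      (continuous_fst.matrix_mulVec continuous_snd)

lemma continuousOn_reQuad {A : ℝ → Matrix n n ℂ} {s : Set ℝ} (hA : ContinuousOn A s)
    (u : Set (n → ℂ)) :
    ContinuousOn (fun p : ℝ × (n → ℂ) => reQuad (A p.1) p.2) (s ×ˢ u) := by
  have h1 : ContinuousOn (fun p : ℝ × (n → ℂ) => A p.1) (s ×ˢ u) :=
    hA.comp continuousOn_fst fun p hp => (Set.mem_prod.1 hp).1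
  have h2 := continuous_reQuad.comp_continuousOn (h1.prodMk continuousOn_snd)
  exact h2

lemma reQuad_add (A B : Matrix n n ℂ) (v : n → ℂ) :
    reQuad (A + B) v = reQuad A v + reQuad B v := by
  simp [reQuad, add_mulVec]

lemma reQuad_sub (A B : Matrix n n ℂ) (v : n → ℂ) :
    reQuad (A - B) v = reQuad A v - reQuad B v := by
  simp [reQuad, sub_mulVec]

lemma reQuad_real_smul (c : ℝ) (A : Matrix n n ℂ) (v : n → ℂ) :
    reQuad ((c : ℂ) • A) v = c * reQuad A v := by
  simp [reQuad, smul_mulVec]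

lemma reQuad_smul_right (c : ℂ) (A : Matrix n n ℂ) (v : n → ℂ) :
    reQuad A (c • v) = ‖c‖ ^ 2 * reQuad A v := by
  have h : star (c • v) ⬝ᵥ A *ᵥ (c • v) = ((‖c‖ ^ 2 : ℝ) : ℂ) * (star v ⬝ᵥ A *ᵥ v) := by
    simp only [star_smul, mulVec_smul, smul_dotProduct, dotProduct_smul, smul_eq_mul]
    rw [← mul_assoc, Complex.star_def, Complex.mul_conj']
    push_cast
    rfl
  rw [reQuad, h, Complex.re_ofReal_mul, reQuad]

lemma reQuad_one_pos [DecidableEq n] {v : n → ℂ} (hv : v ≠ 0) :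
    0 < reQuad (1 : Matrix n n ℂ) v := by
  have := dotProduct_star_self_pos_iff.2 hv
  rw [reQuad, one_mulVec]
  exact (Complex.pos_iff.1 this).1

lemma PosSemidef.reQuad_nonneg {A : Matrix n n ℂ} (hA : A.PosSemidef) (v : n → ℂ) :
    0 ≤ reQuad A v :=
  (Complex.nonneg_iff.1 (hA.dotProduct_mulVec_nonneg v)).1

lemma IsHermitian.posSemidef_of_reQuad_nonneg {A : Matrix n n ℂ} (hA : A.IsHermitian)
    (h : ∀ v, ‖v‖ = 1 → 0 ≤ reQuad A v) : A.PosSemidef := by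
  refine .of_dotProduct_mulVec_nonneg hA fun v => Complex.nonneg_iff.2 ⟨?_, ?_⟩
  · rcases eq_or_ne v 0 with rfl | hv
    · simp
    · have hv' := norm_ne_zero_iff.2 hv
      have h1 := h (((‖v‖⁻¹ : ℝ) : ℂ) • v) (by
        rw [norm_smul, Complex.norm_real, norm_inv, norm_norm, inv_mul_cancel₀ hv'])
      rw [reQuad_smul_right] at h1
      exact nonneg_of_mul_nonneg_right h1 (pow_pos (norm_pos_iff.2 (by simpa using hv)) 2)
  · exact (hA.im_star_dotProduct_mulVec_self v).symm

lemma hasDerivWithinAt_reQuad {y : ℝ → Matrix n n ℂ} {A : Matrix n n ℂ} {s : Set ℝ} {t : ℝ}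
    (h : ∀ i j, HasDerivWithinAt (fun τ => y τ i j) (A i j) s t) (v : n → ℂ) :
    HasDerivWithinAt (fun τ => reQuad (y τ) v) (reQuad A v) s t := by
  have h1 : HasDerivWithinAt (fun τ => star v ⬝ᵥ y τ *ᵥ v) (star v ⬝ᵥ A *ᵥ v) s t := by
    simp only [dotProduct, mulVec]
    exact HasDerivWithinAt.fun_sum fun i _ =>
      (HasDerivWithinAt.fun_sum fun j _ => (h i j).mul_const (v j)).const_mul _
  exact Complex.reCLM.hasFDerivAt.comp_hasDerivWithinAt t h1

/-- On the kernel of a positive semidefinite matrix the transfer generator is nonnegative. -/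
lemma PosSemidef.reQuad_transferGen_nonneg {y : Matrix n n ℂ} (hy : y.PosSemidef)
    (Q : Matrix n n ℂ) (R : ι → Matrix n n ℂ) {v : n → ℂ} (hv : reQuad y v = 0) :
    0 ≤ reQuad (transferGen Q R y) v := by
  have hker : y *ᵥ v = 0 := (hy.dotProduct_mulVec_zero_iff v).1 <|
    Complex.ext hv (hy.1.im_star_dotProduct_mulVec_self v)
  have hker' : star v ᵥ* y = 0 := by
    rw [← hy.1.eq, ← star_mulVec, hker, star_zero]
  have h1 : reQuad (Q * y) v = 0 := by simp [reQuad, ← mulVec_mulVec, hker]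
  have h2 : reQuad (y * Qᴴ) v = 0 := by
    simp [reQuad, ← mulVec_mulVec, dotProduct_mulVec, hker']
  rw [transferGen, reQuad_add, reQuad_add, h1, h2, zero_add, zero_add]
  exact (posSemidef_sum _ fun ν _ => hy.mul_mul_conjTranspose_same (R ν)).reQuad_nonneg v

/-- Comparison principle for strict supersolutions of the transfer equation. -/
lemma reQuad_pos_of_strict_supersolution {T : ℝ} {Q : ℝ → Matrix n n ℂ}
    {R : ι → ℝ → Matrix n n ℂ} {y B : ℝ → Matrix n n ℂ}
    (hy : ∀ t ∈ Set.Icc 0 T, ∀ i j, HasDerivWithinAt (fun τ => y τ i j)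
      ((transferGen (Q t) (fun ν => R ν t) (y t) + B t) i j) (Set.Icc 0 T) t)
    (hherm : ∀ t ∈ Set.Icc 0 T, (y t).IsHermitian)
    (hB : ∀ t ∈ Set.Icc 0 T, ∀ v, ‖v‖ = 1 → 0 < reQuad (B t) v)
    (h0 : ∀ v, ‖v‖ = 1 → 0 < reQuad (y 0) v) :
    ∀ t ∈ Set.Icc 0 T, ∀ v, ‖v‖ = 1 → 0 < reQuad (y t) v := by
  by_contra! hneg
  obtain ⟨t₁, ht₁, v₁, hv₁, hneg⟩ := hneg
  have hycont : ContinuousOn y (Set.Icc 0 T) := by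
    refine continuousOn_pi.2 fun i => continuousOn_pi.2 fun j => ?_
    exact fun t ht => (hy t ht i j).continuousWithinAt
  have hcont : ContinuousOn (fun p : ℝ × (n → ℂ) => reQuad (y p.1) p.2)
      (Set.Icc 0 T ×ˢ Metric.sphere 0 1) := continuousOn_reQuad hycont _
  have hcpt : IsCompact (Set.Icc 0 T ×ˢ Metric.sphere (0 : n → ℂ) 1) :=
    isCompact_Icc.prod (isCompact_sphere 0 1)
  have hbad := hcpt.of_isClosed_subset
    (hcont.preimage_isClosed_of_isClosed hcpt.isClosed (isClosed_Iic (a := (0 : ℝ))))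
    Set.inter_subset_left
  obtain ⟨⟨t, v⟩, ⟨⟨(ht : t ∈ Set.Icc 0 T), hsph⟩, hle⟩, hmin⟩ := hbad.exists_isMinOn
    ⟨(t₁, v₁), ⟨ht₁, by simpa using hv₁⟩, hneg⟩ continuousOn_fst
  have hv : ‖v‖ = 1 := by simpa using hsph
  replace hle : reQuad (y t) v ≤ 0 := hle
  have hbefore : ∀ s ∈ Set.Ico 0 t, ∀ w, ‖w‖ = 1 → 0 < reQuad (y s) w := by
    intro s hs w hw
    by_contra! hcon
    have : t ≤ s := hmin (a := (s, w))
      ⟨⟨⟨hs.1, hs.2.le.trans ht.2⟩, by simpa using hw⟩, hcon⟩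
    exact this.not_gt hs.2
  have htpos : 0 < t := ht.1.lt_of_ne <| by
    intro h
    rw [← h] at hle
    exact (h0 v hv).not_ge hle
  have hsub : Set.Icc 0 t ⊆ Set.Icc 0 T := Set.Icc_subset_Icc_right ht.2
  have hpsd : (y t).PosSemidef := by
    refine (hherm t ht).posSemidef_of_reQuad_nonneg fun w hw => ?_
    have hc : ContinuousWithinAt (fun τ => reQuad (y τ) w) (Set.Ico 0 t) t :=
      (hasDerivWithinAt_reQuad (hy t ht) w).continuousWithinAt.mono
        (Set.Ico_subset_Icc_self.trans hsub)
    refine ContinuousWithinAt.closure_le (f := fun _ => 0) (g := fun τ => reQuad (y τ) w)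
      (s := Set.Ico 0 t) ?_ continuousWithinAt_const hc
      fun s hs => (hbefore s hs w hw).le
    rw [closure_Ico htpos.ne]
    exact ⟨htpos.le, le_rfl⟩
  have hzero : reQuad (y t) v = 0 := le_antisymm hle (hpsd.reQuad_nonneg v)
  have hder := (hasDerivWithinAt_reQuad (hy t ht) v).mono hsub
  have hlocmin : IsLocalMinOn (fun τ => reQuad (y τ) v) (Set.Icc 0 t) t := by
    refine IsMinOn.localize fun s hs => ?_
    change reQuad (y t) v ≤ reQuad (y s) v
    rcases hs.2.eq_or_lt with rfl | hlt
    · exact le_rfl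
    · exact hzero.trans_le (hbefore s ⟨hs.1, hlt⟩ v hv).le
  have hcone : (0 : ℝ) - t ∈ posTangentConeAt (Set.Icc 0 t) t :=
    sub_mem_posTangentConeAt_of_segment_subset <| by
      rw [segment_symm, segment_eq_Icc ht.1]
  have hnonpos := hlocmin.hasFDerivWithinAt_nonneg hder.hasFDerivWithinAt hcone
  have hpos : 0 < reQuad (transferGen (Q t) (fun ν => R ν t) (y t) + B t) v := by
    rw [reQuad_add]
    exact add_pos_of_nonneg_of_pos (hpsd.reQuad_transferGen_nonneg _ _ hzero) (hB t ht v hv)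
  simp only [ContinuousLinearMap.toSpanSingleton_apply, smul_eq_mul] at hnonpos
  nlinarith [mul_pos htpos hpos]

/-- A continuous matrix curve is strictly dominated on compact intervals by a multiple of `1`. -/
lemma exists_reQuad_lt_mul_one [DecidableEq n] {A : ℝ → Matrix n n ℂ} {T : ℝ}
    (hA : ContinuousOn A (Set.Icc 0 T)) :
    ∃ K : ℝ, ∀ t ∈ Set.Icc 0 T, ∀ v, ‖v‖ = 1 →
      reQuad (A t) v < K * reQuad (1 : Matrix n n ℂ) v := by
  have hne : ∀ v : n → ℂ, ‖v‖ = 1 → 0 < reQuad (1 : Matrix n n ℂ) v := fun v hv =>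
    reQuad_one_pos (norm_ne_zero_iff.1 (by rw [hv]; exact one_ne_zero))
  have hcpt : IsCompact (Set.Icc 0 T ×ˢ Metric.sphere (0 : n → ℂ) 1) :=
    isCompact_Icc.prod (isCompact_sphere 0 1)
  have hcont : ContinuousOn
      (fun p : ℝ × (n → ℂ) => reQuad (A p.1) p.2 / reQuad (1 : Matrix n n ℂ) p.2)
      (Set.Icc 0 T ×ˢ Metric.sphere 0 1) := by
    refine ContinuousOn.div ?_ ?_ fun p hp => (hne p.2 (by simpa using hp.2)).ne'
    · exact continuousOn_reQuad hA _
    · exact continuousOn_reQuad continuousOn_const _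
  obtain ⟨C, hC⟩ := hcpt.bddAbove_image hcont
  refine ⟨C + 1, fun t ht v hv => ?_⟩
  rw [← div_lt_iff₀ (hne v hv)]
  exact (hC ⟨(t, v), ⟨ht, by simpa using hv⟩, rfl⟩).trans_lt (lt_add_one C)

/-- Hermitian solutions of the transfer equation stay positive semidefinite. -/
lemma posSemidef_of_isHermitian_solution {Q : ℝ → Matrix n n ℂ} {R : ι → ℝ → Matrix n n ℂ}
    (hQ : ContinuousOn Q (Set.Ici 0)) (hR : ∀ ν, ContinuousOn (R ν) (Set.Ici 0))
    {x : ℝ → Matrix n n ℂ}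
    (hx : ∀ t ∈ Set.Ici (0 : ℝ), ∀ i j, HasDerivWithinAt (fun τ => x τ i j)
      (transferGen (Q t) (fun ν => R ν t) (x t) i j) (Set.Ici 0) t)
    (hherm : ∀ t, 0 ≤ t → (x t).IsHermitian) (hx0 : (x 0).PosSemidef) {T : ℝ} (hT : 0 ≤ T) :
    (x T).PosSemidef := by
  classical
  have hsub : Set.Icc 0 T ⊆ Set.Ici 0 := Set.Icc_subset_Ici_self
  have hL : ContinuousOn (fun t => transferGen (Q t) (fun ν => R ν t) 1) (Set.Icc 0 T) := by
    have hQ' := hQ.mono hsub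
    have hR' := fun ν => (hR ν).mono hsub
    unfold transferGen
    refine ((hQ'.mul continuousOn_const).add (continuousOn_const.mul hQ'.star)).add ?_
    exact continuousOn_finsetSum _ fun ν _ => ((hR' ν).mul continuousOn_const).mul (hR' ν).star
  obtain ⟨K, hK⟩ := exists_reQuad_lt_mul_one hL
  refine (hherm T hT).posSemidef_of_reQuad_nonneg fun v hv => ?_
  have hone : ∀ v : n → ℂ, ‖v‖ = 1 → 0 < reQuad (1 : Matrix n n ℂ) v := fun v hv =>
    reQuad_one_pos (norm_ne_zero_iff.1 (by rw [hv]; exact one_ne_zero))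
  have key : ∀ ε : ℝ, 0 < ε →
      0 < reQuad (x T) v + ε * Real.exp (K * T) * reQuad (1 : Matrix n n ℂ) v := by
    intro ε hε
    have hmain := reQuad_pos_of_strict_supersolution (T := T) (Q := Q) (R := R)
      (y := fun t => x t + ((ε * Real.exp (K * t) : ℝ) : ℂ) • (1 : Matrix n n ℂ))
      (B := fun t => ((ε * Real.exp (K * t) : ℝ) : ℂ) •
        (((K : ℝ) : ℂ) • (1 : Matrix n n ℂ) - transferGen (Q t) (fun ν => R ν t) 1))
      ?_ ?_ ?_ ?_ T ⟨hT, le_rfl⟩ v hv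
    · simpa only [reQuad_add, reQuad_real_smul] using hmain
    · intro t ht i j
      have hexp : HasDerivAt (fun τ : ℝ => ((ε * Real.exp (K * τ) : ℝ) : ℂ))
          ((ε * Real.exp (K * t) * K : ℝ) : ℂ) t := by
        have h1 := (((hasDerivAt_id t).const_mul K).exp.const_mul ε).ofReal_comp
        simpa [mul_assoc] using h1
      have hd := ((hx t (hsub ht) i j).mono hsub).add
        (hexp.hasDerivWithinAt (s := Set.Icc 0 T) |>.mul_const ((1 : Matrix n n ℂ) i j))
      refine hd.congr_deriv ?_
      simp only [transferGen_add, transferGen_smul, add_apply, sub_apply, smul_apply, smul_eq_mul]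
      push_cast
      ring
    · intro t ht
      refine (hherm t ht.1).add ?_
      rw [IsHermitian, conjTranspose_smul, conjTranspose_one, Complex.star_def,
        Complex.conj_ofReal]
    · intro t ht w hw
      rw [reQuad_real_smul, reQuad_sub, reQuad_real_smul]
      exact mul_pos (by positivity) (sub_pos.2 (hK t ht w hw))
    · intro w hw
      rw [reQuad_add, reQuad_real_smul]
      have := hone w hw
      exact add_pos_of_nonneg_of_pos (hx0.reQuad_nonneg w) (by positivity)
  refine le_of_forall_pos_le_add fun δ hδ => ?_
  have hc : 0 < Real.exp (K * T) * reQuad (1 : Matrix n n ℂ) v :=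
    mul_pos (Real.exp_pos _) (hone v hv)
  have := key (δ / (Real.exp (K * T) * reQuad (1 : Matrix n n ℂ) v)) (by positivity)
  rw [mul_assoc, div_mul_cancel₀ _ hc.ne'] at this
  exact this.le

/-- Solutions of the transfer equation with Hermitian initial value stay Hermitian. -/
lemma isHermitian_of_solution {Q : ℝ → Matrix n n ℂ} {R : ι → ℝ → Matrix n n ℂ}
    (hQ : ContinuousOn Q (Set.Ici 0)) (hR : ∀ ν, ContinuousOn (R ν) (Set.Ici 0))
    {x : ℝ → Matrix n n ℂ}
    (hx : ∀ t ∈ Set.Ici (0 : ℝ), ∀ i j, HasDerivWithinAt (fun τ => x τ i j)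
      (transferGen (Q t) (fun ν => R ν t) (x t) i j) (Set.Ici 0) t)
    (hx0 : (x 0).IsHermitian) {t : ℝ} (ht : 0 ≤ t) : (x t).IsHermitian := by
  have hpsd : ∀ c : ℂ, star c = -c → (c • (x t + (-1 : ℂ) • (x t)ᴴ)).PosSemidef := by
    intro c hc
    refine posSemidef_of_isHermitian_solution hQ hR
      (x := fun s => c • (x s + (-1 : ℂ) • (x s)ᴴ)) ?_ ?_ ?_ ht
    · intro s hs i j
      simp only [transferGen_add, transferGen_smul, transferGen_conjTranspose]
      exact ((hx s hs i j).add ((hx s hs j i).star.const_mul (-1))).const_mul c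
    · intro s _
      rw [IsHermitian, conjTranspose_smul, hc]
      simp [add_comm]
    · simp [hx0.eq, PosSemidef.zero]
  have hI := hpsd Complex.I (by simp)
  have hI' := hpsd (-Complex.I) (by simp)
  open scoped MatrixOrder in
  have hzero : Complex.I • (x t + (-1 : ℂ) • (x t)ᴴ) = 0 := by
    refine le_antisymm ?_ hI.nonneg
    simpa using hI'.nonneg
  have := (smul_eq_zero.1 hzero).resolve_left Complex.I_ne_zero
  rw [neg_one_smul, ← sub_eq_add_neg, sub_eq_zero] at this
  exact this.symm

end Matrix

/-- **Positivity preservation of the transfer equation of motion.**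
If `x : [0, ∞) → M_D(ℂ)` is differentiable with
`dx/dt = Q(t) x(t) + x(t) Q(t)† + ∑_ν R_ν(t) x(t) R_ν(t)†` for continuous `Q, R_ν`, and
`x(0)` is positive semidefinite, then `x(t)` is positive semidefinite for all `t ≥ 0`. -/
theorem transfer_eq_preserves_posSemidef (D m : ℕ)
    (Q : ℝ → Matrix (Fin D) (Fin D) ℂ)
    (R : Fin m → ℝ → Matrix (Fin D) (Fin D) ℂ)
    (hQ : ContinuousOn Q (Set.Ici (0 : ℝ)))
    (hR : ∀ ν : Fin m, ContinuousOn (R ν) (Set.Ici (0 : ℝ)))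
    (x : ℝ → Matrix (Fin D) (Fin D) ℂ)
    (hx : ∀ t ∈ Set.Ici (0 : ℝ), ∀ i j : Fin D,
      HasDerivWithinAt (fun τ => x τ i j)
        ((Q t * x t + x t * (Q t)ᴴ + ∑ ν : Fin m, R ν t * x t * (R ν t)ᴴ) i j)
        (Set.Ici (0 : ℝ)) t)
    (hx0 : (x 0).PosSemidef) :
    ∀ t : ℝ, 0 ≤ t → (x t).PosSemidef := by
  intro t ht
  exact posSemidef_of_isHermitian_solution hQ hR hx
    (fun _ hs => isHermitian_of_solution hQ hR hx hx0.1 hs) hx0 ht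
end
end

section
/- Complete positivity of constructed discrete process tensors: Fix d_S, d_E ≥ 1, a positive semidefinite matrix ρ₀ on ℂ^{d_S} ⊗ ℂ^{d_E}, and unitaries U_1, …, U_k on ℂ^{d_S} ⊗ ℂ^{d_E}. Then the k-step process-tensor Choi state Υ̂_k built from ρ₀ and U_1, …, U_k is positive semidefinite. -/
/-!
Complete positivity of constructed discrete process tensors.
-/

noncomputable section
open Matrix Finset
open scoped ComplexOrder

/-- The index type of the `k`-step process-tensor Choi state: the final system leg `o_k`
together with, for each `m < k`, the leg pair `(i_{m+1}, o_m)`. -/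
abbrev PTIdx (dS k : ℕ) := Fin dS × (Fin k → Fin dS × Fin dS)

/-- The environment-open recursion `Υ^E_k`: starting from `ρ₀`, at step `j+1` a fresh
normalized maximally entangled pair `|Φ⁺⟩⟨Φ⁺|` is appended on legs `(i_{j+1}, s)` and the
unitary `U j` is applied to the fresh system factor `s` and the environment.  The entries
below are exactly those of `(U_j)_{s,E} (|Φ⁺⟩⟨Φ⁺| ⊗ Υ^E_j) (U_j)†_{s,E}`, with the newest leg
pair stored at the last position of the leg list. -/
def UpsE (dS dE : ℕ) (ρ0 : Matrix (Fin dS × Fin dE) (Fin dS × Fin dE) ℂ)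
    (U : ℕ → Matrix (Fin dS × Fin dE) (Fin dS × Fin dE) ℂ) :
    (k : ℕ) → Matrix ((Fin dS × Fin dE) × (Fin k → Fin dS × Fin dS))
      ((Fin dS × Fin dE) × (Fin k → Fin dS × Fin dS)) ℂ
  | 0 => Matrix.of fun P Q => ρ0 P.1 Q.1
  | (k + 1) => Matrix.of fun P Q =>
      (dS : ℂ)⁻¹ *
        ∑ ε : Fin dE, ∑ ε' : Fin dE,
          U k P.1 ((P.2 (Fin.last k)).1, ε) *
            UpsE dS dE ρ0 U k
              (((P.2 (Fin.last k)).2, ε), fun m => P.2 m.castSucc)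
              (((Q.2 (Fin.last k)).2, ε'), fun m => Q.2 m.castSucc) *
            (starRingEnd ℂ) (U k Q.1 ((Q.2 (Fin.last k)).1, ε'))

/-- The `k`-step process-tensor Choi state `Υ̂_k = Tr_E Υ^E_k`. -/
def ChoiPT (dS dE : ℕ) (ρ0 : Matrix (Fin dS × Fin dE) (Fin dS × Fin dE) ℂ)
    (U : ℕ → Matrix (Fin dS × Fin dE) (Fin dS × Fin dE) ℂ) (k : ℕ) :
    Matrix (PTIdx dS k) (PTIdx dS k) ℂ :=
  Matrix.of fun P Q => ∑ e : Fin dE, UpsE dS dE ρ0 U k ((P.1, e), P.2) ((Q.1, e), Q.2)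

/-- Compressing a positive semidefinite matrix by a linear combination of its coordinates
preserves positive semidefiniteness. -/
theorem Matrix.PosSemidef.of_sum_conj {m n ι : Type*} [Fintype m] [Fintype n] [Fintype ι]
    {N : Matrix n n ℂ} (hN : N.PosSemidef) (f : m → ι → n) (c : m → ι → ℂ) :
    (Matrix.of fun p q => ∑ ε, ∑ ε', c p ε * N (f p ε) (f q ε') *
      (starRingEnd ℂ) (c q ε')).PosSemidef := by
  classical
  convert hN.mul_mul_conjTranspose_same
    (Matrix.of fun p r => ∑ ε, if f p ε = r then c p ε else 0) using 1
  ext p q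
  simp only [Matrix.mul_apply, Matrix.conjTranspose_apply, Matrix.of_apply, star_sum,
    apply_ite star, star_zero, Finset.sum_mul, Finset.mul_sum, ite_mul, zero_mul, mul_ite,
    mul_zero]
  have collapse (g : ι → n → ℂ) (h : ι → n) :
      ∑ r, ∑ ε, (if h ε = r then g ε r else 0) = ∑ ε, g ε (h ε) := by
    rw [Finset.sum_comm]
    simp
  rw [collapse (fun ε' r => ∑ j, ∑ ε, if f p ε = j then c p ε * N j r * star (c q ε') else 0)]
  rw [Finset.sum_comm]
  exact Finset.sum_congr rfl fun ε' _ =>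
    (collapse (fun ε j => c p ε * N j (f q ε') * star (c q ε')) (f p)).symm

/-- The environment-open state is positive semidefinite at every step. -/
theorem upsE_posSemidef {dS dE : ℕ} {ρ0 : Matrix (Fin dS × Fin dE) (Fin dS × Fin dE) ℂ}
    (hρ0 : ρ0.PosSemidef) (U : ℕ → Matrix (Fin dS × Fin dE) (Fin dS × Fin dE) ℂ) (k : ℕ) :
    (UpsE dS dE ρ0 U k).PosSemidef := by
  induction k with
  | zero => exact hρ0.submatrix Prod.fst
  | succ k ih =>
    have hd : (0 : ℂ) ≤ (dS : ℂ)⁻¹ := by positivity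
    have h := (ih.of_sum_conj
      (fun (P : (Fin dS × Fin dE) × (Fin (k + 1) → Fin dS × Fin dS)) ε =>
        (((P.2 (Fin.last k)).2, ε), fun j => P.2 j.castSucc))
      (fun P ε => U k P.1 ((P.2 (Fin.last k)).1, ε))).smul hd
    rw [UpsE]
    exact h

/-- **Complete positivity of constructed discrete process tensors.**  The `k`-step
process-tensor Choi state built from a positive semidefinite initial state and unitaries is
positive semidefinite. -/
theorem choiPT_posSemidef
    (dS dE : ℕ) (hdS : 1 ≤ dS) (hdE : 1 ≤ dE) (k : ℕ)
    (ρ0 : Matrix (Fin dS × Fin dE) (Fin dS × Fin dE) ℂ) (hρ0 : ρ0.PosSemidef)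
    (U : ℕ → Matrix (Fin dS × Fin dE) (Fin dS × Fin dE) ℂ)
    (hU : ∀ j < k, U j ∈ Matrix.unitaryGroup (Fin dS × Fin dE) ℂ) :
    (ChoiPT dS dE ρ0 U k).PosSemidef := by
  have h : ChoiPT dS dE ρ0 U k = ∑ e : Fin dE,
      (UpsE dS dE ρ0 U k).submatrix (fun P => ((P.1, e), P.2)) (fun P => ((P.1, e), P.2)) := by
    ext P Q
    simp [ChoiPT, Matrix.sum_apply]
  rw [h]
  exact Matrix.posSemidef_sum _ fun e _ => (upsE_posSemidef hρ0 U k).submatrix _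
end
end

section
/- Causality of constructed discrete process tensors: Fix d_S, d_E ≥ 1, a density matrix ρ₀ on ℂ^{d_S} ⊗ ℂ^{d_E}, and unitaries U_1, …, U_k on ℂ^{d_S} ⊗ ℂ^{d_E} (k ≥ 1). Let Υ̂_k be the k-step process-tensor Choi state built from ρ₀ and U_1, …, U_k, and let Υ̂_{k−1} be the (k−1)-step Choi state built from ρ₀ and U_1, …, U_{k−1}. Then Tr_{o_k}[Υ̂_k] = (1/d_S) · 𝟙_{i_k} ⊗ Υ̂_{k−1}, where Tr_{o_k} denotes the partial trace over the final system leg o_k and 𝟙_{i_k} is the identity matrix on the d_S-dimensional leg i_k. -/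
/-!
Causality of constructed discrete process tensors.
-/

noncomputable section
open Matrix Finset
open scoped ComplexOrder

/-- The columns of a unitary matrix are orthonormal. -/
theorem sum_mul_conj_of_mem_unitaryGroup {n : Type*} [Fintype n] [DecidableEq n]
    {U : Matrix n n ℂ} (hU : U ∈ Matrix.unitaryGroup n ℂ) (a b : n) :
    ∑ p, U p a * (starRingEnd ℂ) (U p b) = if a = b then 1 else 0 := by
  have h := congrFun (congrFun (Matrix.mem_unitaryGroup_iff'.mp hU) b) a
  simp only [Matrix.mul_apply, Matrix.star_apply, Matrix.one_apply] at h
  simpa only [mul_comm, eq_comm, starRingEnd_apply] using h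

/-- **Causality of constructed discrete process tensors.**  For a `(k+1)`-step process
tensor, tracing out the final output leg `o_{k+1}` yields `d_S`⁻¹ times the identity on the
final input leg `i_{k+1}` tensored with the `k`-step process tensor, entrywise: here the
newest leg pair `(i_{k+1}, o_k)` of the `(k+1)`-step Choi state is the pair `(i, o)`
appended (`Fin.snoc`) to the remaining legs `r`. -/
theorem choiPT_causal
    (dS dE : ℕ) (hdS : 1 ≤ dS) (hdE : 1 ≤ dE) (k : ℕ)
    (ρ0 : Matrix (Fin dS × Fin dE) (Fin dS × Fin dE) ℂ)
    (hρ0 : ρ0.PosSemidef) (htr : ρ0.trace = 1)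
    (U : ℕ → Matrix (Fin dS × Fin dE) (Fin dS × Fin dE) ℂ)
    (hU : ∀ j < k + 1, U j ∈ Matrix.unitaryGroup (Fin dS × Fin dE) ℂ) :
    ∀ (i i' o o' : Fin dS) (r r' : Fin k → Fin dS × Fin dS),
      (∑ s : Fin dS,
          ChoiPT dS dE ρ0 U (k + 1) (s, Fin.snoc r (i, o)) (s, Fin.snoc r' (i', o'))) =
        (dS : ℂ)⁻¹ * (if i = i' then 1 else 0) * ChoiPT dS dE ρ0 U k (o, r) (o', r') := by
  intro i i' o o' r r'
  have key (M : Fin dE → Fin dE → ℂ) :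
      ∑ p, ∑ ε, ∑ ε', U k p (i, ε) * M ε ε' * (starRingEnd ℂ) (U k p (i', ε')) =
        (if i = i' then 1 else 0) * ∑ e, M e e := by
    calc
      _ = ∑ ε, ∑ ε', M ε ε' * ∑ p, U k p (i, ε) * (starRingEnd ℂ) (U k p (i', ε')) := by
        rw [Finset.sum_comm]
        refine Finset.sum_congr rfl fun ε _ => ?_
        rw [Finset.sum_comm]
        refine Finset.sum_congr rfl fun ε' _ => ?_
        rw [Finset.mul_sum]
        exact Finset.sum_congr rfl fun p _ => by ring
      _ = _ := by
        simp only [sum_mul_conj_of_mem_unitaryGroup (hU k k.lt_succ_self), Prod.mk.injEq]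
        split_ifs with h <;> simp [h]
  have hΥ := key fun ε ε' => UpsE dS dE ρ0 U k ((o, ε), r) ((o', ε'), r')
  rw [Fintype.sum_prod_type] at hΥ
  simp only [ChoiPT, UpsE, Matrix.of_apply, Fin.snoc_last, Fin.snoc_castSucc,
    ← Finset.mul_sum]
  rw [hΥ, mul_assoc]
end
end

section
/- Non-Markovianity is bounded by the entropies of the step marginals: Fix d_S, d_E ≥ 2, a unit vector ψ₀ ∈ ℂ^{d_S} ⊗ ℂ^{d_E}, and unitaries U_1, …, U_k on ℂ^{d_S} ⊗ ℂ^{d_E}. Let Υ̂_k be the k-step process-tensor Choi state built from ρ₀ = |ψ₀⟩⟨ψ₀| and U_1, …, U_k, let Ê_j be the marginal of Υ̂_k on the leg pair (o_j, i_j) for j = 1, …, k, and let ρ̂_0 be the marginal on the leg o_0. Then the relative-entropy non-Markovianity measure satisfies N_S(Υ̂_k) := S(Υ̂_k ‖ Ê_k ⊗ ⋯ ⊗ Ê_1 ⊗ ρ̂_0) ≤ 2 ∑_{j=1}^k S(Ê_j), where S(Ê_j) is the von Neumann entropy of Ê_j. -/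
/-!
Non-Markovianity is bounded by the entropies of the step marginals.
-/

noncomputable section
open Matrix Finset

/-- Spectral matrix logarithm of a Hermitian matrix (with `log 0 = 0` on the kernel). -/
def matLog {n : Type*} [Fintype n] [DecidableEq n] (ρ : Matrix n n ℂ) : Matrix n n ℂ :=
  if h : ρ.IsHermitian then
    (h.eigenvectorUnitary : Matrix n n ℂ) *
      Matrix.diagonal (fun i => (Real.log (h.eigenvalues i) : ℂ)) *
      (star (h.eigenvectorUnitary : Matrix n n ℂ))
  else 0

/-- Quantum relative entropy `S(ρ‖σ) = Tr[ρ log ρ] − Tr[ρ log σ]`. -/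
def relEnt {n : Type*} [Fintype n] [DecidableEq n] (ρ σ : Matrix n n ℂ) : ℝ :=
  ((ρ * matLog ρ).trace - (ρ * matLog σ).trace).re


/-- Von Neumann entropy. -/
def vnEntropy {n : Type*} [Fintype n] [DecidableEq n] (ρ : Matrix n n ℂ) : ℝ :=
  if h : ρ.IsHermitian then -∑ i, h.eigenvalues i * Real.log (h.eigenvalues i) else 0

/-- Marginal of a matrix `M` on a multipartite index set `I`, specified by a projection
`keep` onto the kept legs and a projection `rest` recording (faithfully) the remaining legs:
the `(a, a')` entry is the sum of entries of `M` whose kept legs are `a` resp. `a'` and whose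
remaining legs agree. -/
def marginal {I α β : Type*} [Fintype I] [DecidableEq α] [DecidableEq β]
    (M : Matrix I I ℂ) (keep : I → α) (rest : I → β) : Matrix α α ℂ :=
  Matrix.of fun a a' =>
    ∑ P : I, ∑ Q : I, if keep P = a ∧ keep Q = a' ∧ rest P = rest Q then M P Q else 0

/-- Projection onto the leg pair `(o_{j+1}, i_{j+1})` (`j : Fin k`, i.e. step `j+1`): the
output leg `o_{j+1}` is the second member of cell `j+1` if `j+1 < k` and the standalone final
leg `o_k` otherwise, while the input leg `i_{j+1}` is the first member of cell `j`. -/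
def keepStep {dS k : ℕ} (j : Fin k) (P : PTIdx dS k) : Fin dS × Fin dS :=
  ((if h : (j : ℕ) + 1 < k then (P.2 ⟨(j : ℕ) + 1, h⟩).2 else P.1), (P.2 j).1)

/-- Faithful record of all legs other than `(o_{j+1}, i_{j+1})`. -/
def restStep {dS k : ℕ} (j : Fin k) (P : PTIdx dS k) :
    Option (Fin dS) × (Fin k → Option (Fin dS) × Option (Fin dS)) :=
  ((if (j : ℕ) + 1 < k then some P.1 else none),
    fun m => ((if m = j then none else some (P.2 m).1),
      (if ((m : ℕ) = (j : ℕ) + 1 ∧ (j : ℕ) + 1 < k) then none else some (P.2 m).2)))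

/-- Projection onto the initial leg `o_0`. -/
def keepZero {dS k : ℕ} (P : PTIdx dS k) : Fin dS :=
  if h : 0 < k then (P.2 ⟨0, h⟩).2 else P.1

/-- Faithful record of all legs other than `o_0`. -/
def restZero {dS k : ℕ} (P : PTIdx dS k) :
    Option (Fin dS) × (Fin k → Fin dS × Option (Fin dS)) :=
  ((if 0 < k then some P.1 else none),
    fun m => ((P.2 m).1, (if (m : ℕ) = 0 then none else some (P.2 m).2)))

/-- The single-step marginal `Ê_{j+1}` of the Choi state, on the leg pair `(o_{j+1}, i_{j+1})`. -/
def Ehat (dS dE : ℕ) (ρ0 : Matrix (Fin dS × Fin dE) (Fin dS × Fin dE) ℂ)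
    (U : ℕ → Matrix (Fin dS × Fin dE) (Fin dS × Fin dE) ℂ) (k : ℕ) (j : Fin k) :
    Matrix (Fin dS × Fin dS) (Fin dS × Fin dS) ℂ :=
  marginal (ChoiPT dS dE ρ0 U k) (keepStep j) (restStep j)

/-- The marginal `ρ̂_0` of the Choi state on the initial leg `o_0`. -/
def rho0hat (dS dE : ℕ) (ρ0 : Matrix (Fin dS × Fin dE) (Fin dS × Fin dE) ℂ)
    (U : ℕ → Matrix (Fin dS × Fin dE) (Fin dS × Fin dE) ℂ) (k : ℕ) :
    Matrix (Fin dS) (Fin dS) ℂ :=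
  marginal (ChoiPT dS dE ρ0 U k) keepZero restZero

/-- The tensor product `Ê_k ⊗ ⋯ ⊗ Ê_1 ⊗ ρ̂_0` of the single-step marginals, written as a
matrix on the legs of the Choi state. -/
def markovProduct (dS dE : ℕ) (ρ0 : Matrix (Fin dS × Fin dE) (Fin dS × Fin dE) ℂ)
    (U : ℕ → Matrix (Fin dS × Fin dE) (Fin dS × Fin dE) ℂ) (k : ℕ) :
    Matrix (PTIdx dS k) (PTIdx dS k) ℂ :=
  Matrix.of fun P Q =>
    (∏ j : Fin k, Ehat dS dE ρ0 U k j (keepStep j P) (keepStep j Q)) *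
      rho0hat dS dE ρ0 U k (keepZero P) (keepZero Q)

section SpectralCalculus

variable {m n : Type*} [Fintype m] [DecidableEq m] [Fintype n] [DecidableEq n]

theorem Matrix.IsHermitian.eq_conj_diagonal {ρ : Matrix n n ℂ} (h : ρ.IsHermitian) :
    ρ = (h.eigenvectorUnitary : Matrix n n ℂ) * diagonal (fun i => (h.eigenvalues i : ℂ)) *
      (h.eigenvectorUnitary : Matrix n n ℂ)ᴴ := by
  conv_lhs => rw [h.spectral_theorem]
  rfl

theorem Matrix.IsHermitian.conjTranspose_mul_eigenvectorUnitary {ρ : Matrix n n ℂ}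
    (h : ρ.IsHermitian) :
    (h.eigenvectorUnitary : Matrix n n ℂ)ᴴ * (h.eigenvectorUnitary : Matrix n n ℂ) = 1 := by
  simpa [star_eq_conjTranspose] using Unitary.coe_star_mul_self h.eigenvectorUnitary

theorem Matrix.IsHermitian.eigenvectorUnitary_mul_conjTranspose {ρ : Matrix n n ℂ}
    (h : ρ.IsHermitian) :
    (h.eigenvectorUnitary : Matrix n n ℂ) * (h.eigenvectorUnitary : Matrix n n ℂ)ᴴ = 1 := by
  simpa [star_eq_conjTranspose] using Unitary.coe_mul_star_self h.eigenvectorUnitary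

theorem Matrix.IsHermitian.conjTranspose_mul_mul_eigenvectorUnitary {ρ : Matrix n n ℂ}
    (h : ρ.IsHermitian) :
    (h.eigenvectorUnitary : Matrix n n ℂ)ᴴ * ρ * (h.eigenvectorUnitary : Matrix n n ℂ) =
      diagonal (fun i => (h.eigenvalues i : ℂ)) := by
  set V : Matrix n n ℂ := (h.eigenvectorUnitary : Matrix n n ℂ) with hVdef
  have v1 : Vᴴ * V = 1 := h.conjTranspose_mul_eigenvectorUnitary
  conv_lhs => rw [h.eq_conj_diagonal]
  rw [← hVdef]
  simp only [← Matrix.mul_assoc, v1, Matrix.one_mul]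
  rw [Matrix.mul_assoc, v1, Matrix.mul_one]

omit [Fintype n] [DecidableEq n] in
theorem isHermitian_conj_diagonal (W : Matrix n m ℂ) (d : m → ℝ) :
    (W * diagonal (fun i => (d i : ℂ)) * Wᴴ).IsHermitian :=
  isHermitian_mul_mul_conjTranspose W (isHermitian_diagonal_of_self_adjoint _ (by
    ext i; simp))

/-- The spectral logarithm may be computed in any eigenbasis. -/
theorem matLog_conj_diagonal (W : Matrix n m ℂ) (d : m → ℝ) (h1 : Wᴴ * W = 1) (h2 : W * Wᴴ = 1) :
    matLog (W * diagonal (fun i => (d i : ℂ)) * Wᴴ) =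
      W * diagonal (fun i => (Real.log (d i) : ℂ)) * Wᴴ := by
  have h := isHermitian_conj_diagonal W d
  have hV := h.eq_conj_diagonal
  rw [matLog, dif_pos h]
  set V : Matrix n n ℂ := (h.eigenvectorUnitary : Matrix n n ℂ) with hVdef
  have v1 : Vᴴ * V = 1 := h.conjTranspose_mul_eigenvectorUnitary
  have v2 : V * Vᴴ = 1 := h.eigenvectorUnitary_mul_conjTranspose
  have key : (Vᴴ * W) * diagonal (fun i => (d i : ℂ)) =
      diagonal (fun i => (h.eigenvalues i : ℂ)) * (Vᴴ * W) := by
    calc (Vᴴ * W) * diagonal (fun i => (d i : ℂ))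
        = Vᴴ * (W * diagonal (fun i => (d i : ℂ)) * Wᴴ) * W := by
          simp only [Matrix.mul_assoc, h1, Matrix.mul_one]
      _ = Vᴴ * (V * diagonal (fun i => (h.eigenvalues i : ℂ)) * Vᴴ) * W := by rw [← hV]
      _ = (Vᴴ * V) * diagonal (fun i => (h.eigenvalues i : ℂ)) * (Vᴴ * W) := by
          simp only [Matrix.mul_assoc]
      _ = _ := by rw [v1, Matrix.one_mul]
  have key' : (Vᴴ * W) * diagonal (fun i => (Real.log (d i) : ℂ)) =
      diagonal (fun i => (Real.log (h.eigenvalues i) : ℂ)) * (Vᴴ * W) := by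
    ext i j
    have := congrFun (congrFun key i) j
    rw [mul_diagonal, diagonal_mul] at this ⊢
    by_cases hz : (Vᴴ * W) i j = 0
    · simp [hz]
    · rw [mul_comm] at this
      have h3 := mul_right_cancel₀ hz this
      rw [Complex.ofReal_inj.mp h3, mul_comm]
  calc V * diagonal (fun i => (Real.log (h.eigenvalues i) : ℂ)) * star V
      = V * (diagonal (fun i => (Real.log (h.eigenvalues i) : ℂ)) * (Vᴴ * W)) * Wᴴ := by
        rw [star_eq_conjTranspose]; simp only [Matrix.mul_assoc, h2, Matrix.mul_one]
    _ = (V * Vᴴ) * W * diagonal (fun i => (Real.log (d i) : ℂ)) * Wᴴ := by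
        rw [← key']; simp only [Matrix.mul_assoc]
    _ = _ := by rw [v2, Matrix.one_mul]

omit [DecidableEq n] in
theorem trace_mul_conj_diagonal (ρ : Matrix n n ℂ) (W : Matrix n m ℂ) (d : m → ℂ) :
    (ρ * (W * diagonal d * Wᴴ)).trace = ∑ x, (Wᴴ * ρ * W) x x * d x := by
  rw [← Matrix.mul_assoc, trace_mul_comm, ← Matrix.mul_assoc, ← Matrix.mul_assoc]
  simp [trace, mul_diagonal]

theorem trace_mul_matLog_self {ρ : Matrix n n ℂ} (h : ρ.IsHermitian) :
    (ρ * matLog ρ).trace.re = -vnEntropy ρ := by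
  rw [matLog, dif_pos h, star_eq_conjTranspose, trace_mul_conj_diagonal,
    h.conjTranspose_mul_mul_eigenvectorUnitary, vnEntropy, dif_pos h]
  simp

theorem matLog_submatrix (e : m ≃ n) (ρ : Matrix n n ℂ) :
    matLog (ρ.submatrix e e) = (matLog ρ).submatrix e e := by
  by_cases h : ρ.IsHermitian
  · set V : Matrix n n ℂ := (h.eigenvectorUnitary : Matrix n n ℂ) with hVdef
    have v1 : Vᴴ * V = 1 := h.conjTranspose_mul_eigenvectorUnitary
    have v2 : V * Vᴴ = 1 := h.eigenvectorUnitary_mul_conjTranspose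
    have hsub (D : Matrix n n ℂ) : (V * D * Vᴴ).submatrix e e =
        V.submatrix e id * D * (V.submatrix e id)ᴴ := by
      ext i j; simp [Matrix.mul_apply]
    have hL : matLog ρ = V * diagonal (fun i => (Real.log (h.eigenvalues i) : ℂ)) * Vᴴ := by
      rw [matLog, dif_pos h, star_eq_conjTranspose]
    rw [hL]
    conv_lhs => rw [h.eq_conj_diagonal, ← hVdef]
    rw [hsub, hsub, matLog_conj_diagonal]
    · rw [conjTranspose_submatrix, submatrix_mul_equiv, v1, submatrix_id_id]
    · rw [conjTranspose_submatrix, ← submatrix_mul _ _ _ _ _ Function.bijective_id, v2,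
        submatrix_one_equiv]
  · have h' : ¬ (ρ.submatrix e e).IsHermitian := fun h' => h (by
      have := h'.submatrix e.symm
      simpa using this)
    rw [matLog, matLog, dif_neg h, dif_neg h']
    rfl

theorem relEnt_submatrix (e : m ≃ n) (ρ σ : Matrix n n ℂ) :
    relEnt (ρ.submatrix e e) (σ.submatrix e e) = relEnt ρ σ := by
  have ht (A : Matrix n n ℂ) : (A.submatrix e e).trace = A.trace :=
    e.sum_comp (fun i => A i i)
  simp only [relEnt, matLog_submatrix, submatrix_mul_equiv, ht]

theorem vnEntropy_eq_sum_roots {ρ : Matrix n n ℂ} (h : ρ.IsHermitian) :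
    vnEntropy ρ = (ρ.charpoly.roots.map fun z => Real.negMulLog z.re).sum := by
  rw [vnEntropy, dif_pos h, h.roots_charpoly_eq_eigenvalues, Multiset.map_map]
  simp [Real.negMulLog, Finset.sum_neg_distrib]

theorem sum_negMulLog_roots_X_pow_mul (B : Matrix n n ℂ) (k : ℕ) :
    (((Polynomial.X : Polynomial ℂ) ^ k * B.charpoly).roots.map fun z => Real.negMulLog z.re).sum =
      (B.charpoly.roots.map fun z => Real.negMulLog z.re).sum := by
  rw [Polynomial.roots_mul (mul_ne_zero (pow_ne_zero _ Polynomial.X_ne_zero)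
    B.charpoly_monic.ne_zero)]
  simp [Multiset.map_nsmul, Multiset.sum_nsmul]

/-- The two reduced states of a pure bipartite state have the same entropy. -/
theorem vnEntropy_transpose_mul (N : Matrix m n ℂ) :
    vnEntropy (Nᵀ * Nᵀᴴ) = vnEntropy (N * Nᴴ) := by
  have hT : Nᵀ * Nᵀᴴ = (Nᴴ * N)ᵀ := by
    rw [transpose_mul]; rfl
  rw [vnEntropy_eq_sum_roots (isHermitian_mul_conjTranspose_self _),
    vnEntropy_eq_sum_roots (isHermitian_mul_conjTranspose_self _), hT, charpoly_transpose]
  have h := congrArg (fun p : Polynomial ℂ => (p.roots.map fun z => Real.negMulLog z.re).sum)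
    (charpoly_mul_comm' N Nᴴ)
  simp only [sum_negMulLog_roots_X_pow_mul] at h
  exact h.symm

open scoped ComplexOrder in
/-- Klein's inequality, for `σ = W diag(q) Wᴴ`. -/
theorem trace_mul_matLog_ge {ρ : Matrix n n ℂ} (hρ : ρ.PosSemidef) (W : Matrix n m ℂ) (q : m → ℝ)
    (h1 : Wᴴ * W = 1) (h2 : W * Wᴴ = 1) (hq : ∀ x, 0 ≤ q x)
    (hsum : ∑ x, q x ≤ ρ.trace.re) (hsupp : ∀ x, q x = 0 → (Wᴴ * ρ * W) x x = 0) :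
    ∑ x, ((Wᴴ * ρ * W) x x).re * Real.log (q x) ≤ -vnEntropy ρ := by
  have h := hρ.isHermitian
  set V : Matrix n n ℂ := (h.eigenvectorUnitary : Matrix n n ℂ) with hVdef
  have v1 : Vᴴ * V = 1 := h.conjTranspose_mul_eigenvectorUnitary
  have v2 : V * Vᴴ = 1 := h.eigenvectorUnitary_mul_conjTranspose
  set D : m → n → ℝ := fun x k => ‖(Wᴴ * V) x k‖ ^ 2 with hD
  have hDsq (x : m) (k : n) : ((D x k : ℝ) : ℂ) = (Wᴴ * V) x k * (Vᴴ * W) k x := by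
    have : (Vᴴ * W) k x = star ((Wᴴ * V) x k) := by
      rw [← conjTranspose_apply, conjTranspose_mul, conjTranspose_conjTranspose]
    rw [this, hD]
    simp [Complex.mul_conj, Complex.normSq_eq_norm_sq]
  have hp (x : m) : (Wᴴ * ρ * W) x x = ((∑ k, D x k * h.eigenvalues k : ℝ) : ℂ) := by
    conv_lhs => rw [h.eq_conj_diagonal, ← hVdef]
    have : Wᴴ * (V * diagonal (fun i => (h.eigenvalues i : ℂ)) * Vᴴ) * W =
      (Wᴴ * V) * diagonal (fun i => (h.eigenvalues i : ℂ)) * (Vᴴ * W) := by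
      simp only [Matrix.mul_assoc]
    rw [this, Matrix.mul_apply]
    push_cast
    refine Finset.sum_congr rfl fun k _ => ?_
    rw [mul_diagonal, hDsq]; ring
  have hD1 (x : m) : ∑ k, D x k = 1 := by
    have : ((∑ k, D x k : ℝ) : ℂ) = 1 := by
      push_cast
      simp only [hDsq]
      rw [← Matrix.mul_apply, Matrix.mul_assoc, ← Matrix.mul_assoc V, v2, Matrix.one_mul, h1,
        one_apply_eq]
    exact_mod_cast this
  have hD2 (k : n) : ∑ x, D x k = 1 := by
    have : ((∑ x, D x k : ℝ) : ℂ) = 1 := by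
      push_cast
      simp only [hDsq, mul_comm ((Wᴴ * V) _ _)]
      rw [← Matrix.mul_apply, Matrix.mul_assoc, ← Matrix.mul_assoc W, h2, Matrix.one_mul, v1,
        one_apply_eq]
    exact_mod_cast this
  have hl (k : n) : 0 ≤ h.eigenvalues k := hρ.eigenvalues_nonneg k
  have hD0 (x : m) (k : n) : 0 ≤ D x k := sq_nonneg _
  have hterm (x : m) (k : n) : D x k * (h.eigenvalues k - q x) ≤
      D x k * (h.eigenvalues k * Real.log (h.eigenvalues k)) -
        D x k * h.eigenvalues k * Real.log (q x) := by
    rcases (hq x).eq_or_lt with hqx | hqx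
    · have h0 := hsupp x hqx.symm
      rw [hp, Complex.ofReal_eq_zero,
        Finset.sum_eq_zero_iff_of_nonneg fun k _ => mul_nonneg (hD0 x k) (hl k)] at h0
      have h0 := h0 k (Finset.mem_univ k)
      rw [← mul_assoc, mul_sub, h0, ← hqx]
      simp
    · rw [mul_assoc, ← mul_sub]
      refine mul_le_mul_of_nonneg_left ?_ (hD0 x k)
      rcases (hl k).eq_or_lt with hk | hk
      · rw [← hk]; simp [hqx.le]
      · have := Real.log_le_sub_one_of_pos (div_pos hqx hk)
        rw [Real.log_div hqx.ne' hk.ne'] at this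
        have := mul_le_mul_of_nonneg_left this hk.le
        have h4 : h.eigenvalues k * (q x / h.eigenvalues k - 1) = q x - h.eigenvalues k := by
          field_simp
        rw [h4] at this
        linarith
  have htot := Finset.sum_le_sum fun x (_ : x ∈ univ) =>
    Finset.sum_le_sum fun k (_ : k ∈ univ) => hterm x k
  have hleft : ∑ x, ∑ k, D x k * (h.eigenvalues k - q x) = ρ.trace.re - ∑ x, q x := by
    simp only [mul_sub, Finset.sum_sub_distrib, ← Finset.sum_mul, hD1, one_mul]
    rw [Finset.sum_comm]
    simp only [← Finset.sum_mul, hD2, one_mul]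
    rw [h.trace_eq_sum_eigenvalues]
    simp
  have hright : ∑ x, ∑ k, (D x k * (h.eigenvalues k * Real.log (h.eigenvalues k)) -
        D x k * h.eigenvalues k * Real.log (q x)) =
      -vnEntropy ρ - ∑ x, ((Wᴴ * ρ * W) x x).re * Real.log (q x) := by
    simp only [Finset.sum_sub_distrib, ← Finset.sum_mul, hp, Complex.ofReal_re]
    rw [Finset.sum_comm]
    simp only [← Finset.sum_mul, hD2, one_mul]
    rw [vnEntropy, dif_pos h, neg_neg]
  rw [hleft, hright] at htot
  linarith

end SpectralCalculus

section ProductStructure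

variable {ι X Y : Type*} [Fintype ι] [DecidableEq ι] [Fintype X] [DecidableEq X]
  [Fintype Y] [DecidableEq Y]

/-- The tensor product `(⨂ j, u j) ⊗ v`. -/
def piKronecker (u : ι → Matrix X X ℂ) (v : Matrix Y Y ℂ) :
    Matrix ((ι → X) × Y) ((ι → X) × Y) ℂ :=
  Matrix.of fun P Q => (∏ j, u j (P.1 j) (Q.1 j)) * v P.2 Q.2

omit [DecidableEq X] [DecidableEq Y] in
theorem piKronecker_mul (u u' : ι → Matrix X X ℂ) (v v' : Matrix Y Y ℂ) :
    piKronecker u v * piKronecker u' v' = piKronecker (fun j => u j * u' j) (v * v') := by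
  ext P Q
  simp only [piKronecker, Matrix.mul_apply, Matrix.of_apply, Fintype.sum_prod_type]
  rw [Fintype.prod_sum, Finset.sum_mul_sum]
  refine Finset.sum_congr rfl fun f _ => Finset.sum_congr rfl fun y _ => ?_
  rw [Finset.prod_mul_distrib]
  ring

omit [DecidableEq ι] [Fintype X] [DecidableEq X] [Fintype Y] [DecidableEq Y] in
theorem conjTranspose_piKronecker (u : ι → Matrix X X ℂ) (v : Matrix Y Y ℂ) :
    (piKronecker u v)ᴴ = piKronecker (fun j => (u j)ᴴ) vᴴ := by
  ext P Q
  simp [piKronecker, conjTranspose_apply]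

omit [DecidableEq ι] [Fintype X] [Fintype Y] in
theorem piKronecker_diagonal (d : ι → X → ℂ) (e : Y → ℂ) :
    piKronecker (fun j => diagonal (d j)) (diagonal e) =
      diagonal fun x => (∏ j, d j (x.1 j)) * e x.2 := by
  ext P Q
  rcases eq_or_ne P Q with rfl | h
  · simp [piKronecker]
  · rw [diagonal_apply_ne _ h]
    simp only [piKronecker, Matrix.of_apply, mul_eq_zero, Finset.prod_eq_zero_iff]
    by_cases h2 : P.2 = Q.2
    · left
      obtain ⟨j, hj⟩ := Function.ne_iff.mp fun h1 => h (Prod.ext h1 h2)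
      exact ⟨j, Finset.mem_univ j, diagonal_apply_ne _ hj⟩
    · right
      exact diagonal_apply_ne _ h2

omit [DecidableEq ι] [Fintype X] [Fintype Y] in
theorem piKronecker_one : piKronecker (fun _ : ι => (1 : Matrix X X ℂ)) (1 : Matrix Y Y ℂ) = 1 := by
  simp only [← diagonal_one, piKronecker_diagonal]
  simp

/-- The marginal on the `j`-th factor of `(ι → X) × Y`. -/
def marginalPi (ρ : Matrix ((ι → X) × Y) ((ι → X) × Y) ℂ) (j : ι) : Matrix X X ℂ :=
  Matrix.of fun a a' => ∑ P, ∑ Q,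
    if P.1 j = a ∧ Q.1 j = a' ∧ ((∀ i, i ≠ j → P.1 i = Q.1 i) ∧ P.2 = Q.2) then ρ P Q else 0

/-- The marginal on the last factor of `(ι → X) × Y`. -/
def marginalLast (ρ : Matrix ((ι → X) × Y) ((ι → X) × Y) ℂ) : Matrix Y Y ℂ :=
  Matrix.of fun a a' => ∑ P, ∑ Q,
    if P.2 = a ∧ Q.2 = a' ∧ (∀ i, P.1 i = Q.1 i) then ρ P Q else 0

omit [DecidableEq ι] [Fintype X] [Fintype Y] [DecidableEq Y] in
theorem piKronecker_one_apply (O : Matrix Y Y ℂ) (P Q : (ι → X) × Y) :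
    piKronecker (fun _ => 1) O P Q = if ∀ i, P.1 i = Q.1 i then O P.2 Q.2 else 0 := by
  simp [piKronecker, Matrix.one_apply, Finset.prod_ite_zero]

omit [Fintype X] [Fintype Y] in
theorem piKronecker_update_apply (O : Matrix X X ℂ) (j : ι) (P Q : (ι → X) × Y) :
    piKronecker (Function.update (fun _ => 1) j O) (1 : Matrix Y Y ℂ) P Q =
      if (∀ i, i ≠ j → P.1 i = Q.1 i) ∧ P.2 = Q.2 then O (P.1 j) (Q.1 j) else 0 := by
  have h (i : ι) : Function.update (fun _ => (1 : Matrix X X ℂ)) j O i (P.1 i) (Q.1 i) =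
      (if i = j then O (P.1 j) (Q.1 j) else 1) * if i ≠ j → P.1 i = Q.1 i then 1 else 0 := by
    rcases eq_or_ne i j with rfl | hij
    · simp
    · simp [hij, Matrix.one_apply]
  simp only [piKronecker, Matrix.of_apply, h, Finset.prod_mul_distrib, Finset.prod_ite_zero,
    Finset.prod_ite_eq', Finset.mem_univ, if_true, Finset.prod_const_one, Matrix.one_apply,
    forall_const]
  split_ifs <;> simp_all

theorem trace_marginalPi_mul (ρ : Matrix ((ι → X) × Y) ((ι → X) × Y) ℂ) (j : ι)
    (O : Matrix X X ℂ) :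
    (marginalPi ρ j * O).trace =
      (ρ * piKronecker (Function.update (fun _ => 1) j O) 1).trace := by
  simp only [trace, diag_apply, Matrix.mul_apply, piKronecker_update_apply, marginalPi,
    Matrix.of_apply, Finset.sum_mul]
  rw [Finset.sum_congr rfl fun a _ => Finset.sum_comm, Finset.sum_comm]
  refine Finset.sum_congr rfl fun P _ => ?_
  rw [Finset.sum_congr rfl fun a _ => Finset.sum_comm, Finset.sum_comm]
  refine Finset.sum_congr rfl fun Q _ => ?_
  have hs (a a' : X) : (if P.1 j = a ∧ Q.1 j = a' ∧
      ((∀ i, i ≠ j → P.1 i = Q.1 i) ∧ P.2 = Q.2) then ρ P Q else 0) * O a' a =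
      if P.1 j = a then if Q.1 j = a' then
        if (∀ i, i ≠ j → P.1 i = Q.1 i) ∧ P.2 = Q.2 then ρ P Q * O a' a else 0 else 0 else 0 := by
    split_ifs <;> simp_all
  simp only [hs, Finset.sum_ite_irrel, Finset.sum_ite_eq, Finset.mem_univ, if_true,
    Finset.sum_const_zero, mul_ite, mul_zero]
  refine if_congr ?_ rfl rfl
  exact ⟨fun h => ⟨fun i hi => (h.1 i hi).symm, h.2.symm⟩,
    fun h => ⟨fun i hi => (h.1 i hi).symm, h.2.symm⟩⟩

theorem trace_marginalLast_mul (ρ : Matrix ((ι → X) × Y) ((ι → X) × Y) ℂ)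
    (O : Matrix Y Y ℂ) :
    (marginalLast ρ * O).trace = (ρ * piKronecker (fun _ => 1) O).trace := by
  simp only [trace, diag_apply, Matrix.mul_apply, piKronecker_one_apply, marginalLast,
    Matrix.of_apply, Finset.sum_mul]
  rw [Finset.sum_congr rfl fun a _ => Finset.sum_comm, Finset.sum_comm]
  refine Finset.sum_congr rfl fun P _ => ?_
  rw [Finset.sum_congr rfl fun a _ => Finset.sum_comm, Finset.sum_comm]
  refine Finset.sum_congr rfl fun Q _ => ?_
  have hs (a a' : Y) : (if P.2 = a ∧ Q.2 = a' ∧ (∀ i, P.1 i = Q.1 i) then ρ P Q else 0) * O a' a =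
      if P.2 = a then if Q.2 = a' then
        if ∀ i, P.1 i = Q.1 i then ρ P Q * O a' a else 0 else 0 else 0 := by
    split_ifs <;> simp_all
  simp only [hs, Finset.sum_ite_irrel, Finset.sum_ite_eq, Finset.mem_univ, if_true,
    Finset.sum_const_zero, mul_ite, mul_zero]
  exact if_congr ⟨fun h i => (h i).symm, fun h i => (h i).symm⟩ rfl rfl

theorem marginalPi_apply (ρ : Matrix ((ι → X) × Y) ((ι → X) × Y) ℂ) (j : ι) (a a' : X) :
    marginalPi ρ j a a' = ∑ f : ι → X, ∑ f' : ι → X,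
      if f j = a ∧ f' j = a' ∧ ∀ i, i ≠ j → f i = f' i then ∑ y, ρ (f, y) (f', y) else 0 := by
  simp only [marginalPi, Matrix.of_apply, Fintype.sum_prod_type]
  refine Finset.sum_congr rfl fun f _ => ?_
  rw [Finset.sum_comm]
  refine Finset.sum_congr rfl fun f' _ => ?_
  split_ifs with h
  · refine Finset.sum_congr rfl fun y _ => ?_
    have h3 : ∀ i, ¬i = j → f i = f' i := h.2.2
    simp only [h.1, h.2.1, ne_eq, true_and, eq_true h3]
    simp
  · refine Finset.sum_eq_zero fun y _ => Finset.sum_eq_zero fun y' _ => if_neg ?_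
    exact fun h' => h ⟨h'.1, h'.2.1, h'.2.2.1⟩

theorem marginalLast_apply (ρ : Matrix ((ι → X) × Y) ((ι → X) × Y) ℂ) (a a' : Y) :
    marginalLast ρ a a' = ∑ f : ι → X, ρ (f, a) (f, a') := by
  simp only [marginalLast, Matrix.of_apply, Fintype.sum_prod_type, ← funext_iff, ite_and]
  simp

theorem isHermitian_marginalPi {ρ : Matrix ((ι → X) × Y) ((ι → X) × Y) ℂ} (h : ρ.IsHermitian)
    (j : ι) : (marginalPi ρ j).IsHermitian := by
  ext a a'
  simp only [conjTranspose_apply, marginalPi, Matrix.of_apply, star_sum]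
  rw [Finset.sum_comm]
  refine Finset.sum_congr rfl fun P _ => Finset.sum_congr rfl fun Q _ => ?_
  rw [apply_ite star, h.apply, star_zero]
  refine if_congr ?_ rfl rfl
  exact ⟨fun h => ⟨h.2.1, h.1, fun i hi => (h.2.2.1 i hi).symm, h.2.2.2.symm⟩,
    fun h => ⟨h.2.1, h.1, fun i hi => (h.2.2.1 i hi).symm, h.2.2.2.symm⟩⟩

theorem isHermitian_marginalLast {ρ : Matrix ((ι → X) × Y) ((ι → X) × Y) ℂ}
    (h : ρ.IsHermitian) : (marginalLast ρ).IsHermitian := by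
  ext a a'
  simp only [conjTranspose_apply, marginalLast, Matrix.of_apply, star_sum]
  rw [Finset.sum_comm]
  refine Finset.sum_congr rfl fun P _ => Finset.sum_congr rfl fun Q _ => ?_
  rw [apply_ite star, h.apply, star_zero]
  refine if_congr ?_ rfl rfl
  exact ⟨fun h => ⟨h.2.1, h.1, fun i => (h.2.2 i).symm⟩,
    fun h => ⟨h.2.1, h.1, fun i => (h.2.2 i).symm⟩⟩

end ProductStructure

section ProductOfMarginals

open scoped ComplexOrder

variable {ι X Y : Type*} [Fintype ι] [DecidableEq ι] [Fintype X] [DecidableEq X]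
  [Fintype Y] [DecidableEq Y]

/-- Data of the eigenbases of all marginals of `ρ`: the product distribution `q` of the
eigenvalues and the diagonal `p` of `ρ` in the product eigenbasis `W`. -/
theorem exists_productEigenbasis {ρ : Matrix ((ι → X) × Y) ((ι → X) × Y) ℂ}
    (hρ : ρ.PosSemidef) (htr : ρ.trace = 1) :
    ∃ (W : Matrix ((ι → X) × Y) ((ι → X) × Y) ℂ) (q : (ι → X) × Y → ℝ),
      Wᴴ * W = 1 ∧ W * Wᴴ = 1 ∧ (∀ x, 0 ≤ q x) ∧ ∑ x, q x = 1 ∧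
      (∀ x, q x = 0 → (Wᴴ * ρ * W) x x = 0) ∧
      piKronecker (marginalPi ρ) (marginalLast ρ) = W * diagonal (fun x => (q x : ℂ)) * Wᴴ ∧
      ∑ x, ((Wᴴ * ρ * W) x x).re * Real.log (q x) =
        -(∑ j, vnEntropy (marginalPi ρ j) + vnEntropy (marginalLast ρ)) := by
  have hA := isHermitian_marginalPi hρ.isHermitian
  have hB := isHermitian_marginalLast hρ.isHermitian
  set u : ι → Matrix X X ℂ := fun j => ((hA j).eigenvectorUnitary : Matrix X X ℂ) with hu
  set v : Matrix Y Y ℂ := (hB.eigenvectorUnitary : Matrix Y Y ℂ) with hv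
  have u1 (j : ι) : (u j)ᴴ * u j = 1 := (hA j).conjTranspose_mul_eigenvectorUnitary
  have u2 (j : ι) : u j * (u j)ᴴ = 1 := (hA j).eigenvectorUnitary_mul_conjTranspose
  have v1 : vᴴ * v = 1 := hB.conjTranspose_mul_eigenvectorUnitary
  have v2 : v * vᴴ = 1 := hB.eigenvectorUnitary_mul_conjTranspose
  set W := piKronecker u v with hW
  set p : (ι → X) × Y → ℝ := fun x => ((Wᴴ * ρ * W) x x).re with hp
  have hpsd : (Wᴴ * ρ * W).PosSemidef := hρ.conjTranspose_mul_mul_same W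
  have hp0 (x) : 0 ≤ p x := (Complex.nonneg_iff.mp (hpsd.diag_nonneg (i := x))).1
  have hpC (x) : (Wᴴ * ρ * W) x x = (p x : ℂ) :=
    Complex.ext rfl (by simpa using (Complex.nonneg_iff.mp (hpsd.diag_nonneg (i := x))).2.symm)
  have w1 : Wᴴ * W = 1 := by
    rw [hW, conjTranspose_piKronecker, piKronecker_mul, ← piKronecker_one]
    simp only [u1, v1]
  have w2 : W * Wᴴ = 1 := by
    rw [hW, conjTranspose_piKronecker, piKronecker_mul, ← piKronecker_one]
    simp only [u2, v2]
  have margA (j : ι) (g : X → ℝ) :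
      ∑ x, p x * g (x.1 j) = ∑ a, (hA j).eigenvalues a * g a := by
    have h1 := trace_marginalPi_mul ρ j (u j * diagonal (fun a => (g a : ℂ)) * (u j)ᴴ)
    have h2 : piKronecker (Function.update (fun _ => 1) j
        (u j * diagonal (fun a => (g a : ℂ)) * (u j)ᴴ)) (1 : Matrix Y Y ℂ) =
        W * diagonal (fun x => (g (x.1 j) : ℂ)) * Wᴴ := by
      have h3 : (diagonal (fun x => (g (x.1 j) : ℂ)) : Matrix ((ι → X) × Y) ((ι → X) × Y) ℂ) =
          piKronecker (fun i => diagonal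
            (if i = j then fun a => (g a : ℂ) else fun _ => 1)) (diagonal fun _ => 1) := by
        rw [piKronecker_diagonal]
        congr 1
        ext x
        simp [ite_apply]
      rw [h3, hW, conjTranspose_piKronecker, piKronecker_mul, piKronecker_mul]
      congr 1
      · ext1 i
        rcases eq_or_ne i j with rfl | hij
        · simp
        · simp [hij, u2]
      · simp [v2]
    rw [h2, trace_mul_conj_diagonal, trace_mul_conj_diagonal] at h1
    have h4 : (u j)ᴴ * marginalPi ρ j * u j = diagonal fun a => ((hA j).eigenvalues a : ℂ) :=
      (hA j).conjTranspose_mul_mul_eigenvectorUnitary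
    rw [h4] at h1
    simp only [hpC, diagonal_apply_eq] at h1
    exact_mod_cast h1.symm
  have margB (g : Y → ℝ) : ∑ x, p x * g x.2 = ∑ a, hB.eigenvalues a * g a := by
    have h1 := trace_marginalLast_mul ρ (v * diagonal (fun a => (g a : ℂ)) * vᴴ)
    have h2 : piKronecker (fun _ : ι => (1 : Matrix X X ℂ))
        (v * diagonal (fun a => (g a : ℂ)) * vᴴ) =
        W * diagonal (fun x => (g x.2 : ℂ)) * Wᴴ := by
      have h3 : (diagonal (fun x => (g x.2 : ℂ)) : Matrix ((ι → X) × Y) ((ι → X) × Y) ℂ) =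
          piKronecker (fun _ => diagonal fun _ => 1) (diagonal fun a => (g a : ℂ)) := by
        rw [piKronecker_diagonal]
        simp
      rw [h3, hW, conjTranspose_piKronecker, piKronecker_mul, piKronecker_mul]
      simp [u2]
    rw [h2, trace_mul_conj_diagonal, trace_mul_conj_diagonal] at h1
    have h4 : vᴴ * marginalLast ρ * v = diagonal fun a => (hB.eigenvalues a : ℂ) :=
      hB.conjTranspose_mul_mul_eigenvectorUnitary
    rw [h4] at h1
    simp only [hpC, diagonal_apply_eq] at h1
    exact_mod_cast h1.symm
  have eA (j : ι) (a : X) : (hA j).eigenvalues a = ∑ x, p x * if x.1 j = a then 1 else 0 := by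
    rw [margA j fun b => if b = a then 1 else 0]
    simp
  have eB (a : Y) : hB.eigenvalues a = ∑ x, p x * if x.2 = a then 1 else 0 := by
    rw [margB fun b => if b = a then 1 else 0]
    simp
  have hterm0 (x) (P : Prop) [Decidable P] : 0 ≤ p x * if P then 1 else 0 :=
    mul_nonneg (hp0 x) (by split_ifs <;> norm_num)
  have eA0 (j : ι) (a : X) : 0 ≤ (hA j).eigenvalues a := by
    rw [eA]; exact Finset.sum_nonneg fun x _ => hterm0 x _
  have eB0 (a : Y) : 0 ≤ hB.eigenvalues a := by
    rw [eB]; exact Finset.sum_nonneg fun x _ => hterm0 x _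
  have pA (x) (j : ι) (h : (hA j).eigenvalues (x.1 j) = 0) : p x = 0 := by
    rw [eA, Finset.sum_eq_zero_iff_of_nonneg fun x _ => hterm0 x _] at h
    simpa using h x (Finset.mem_univ x)
  have pB (x) (h : hB.eigenvalues x.2 = 0) : p x = 0 := by
    rw [eB, Finset.sum_eq_zero_iff_of_nonneg fun x _ => hterm0 x _] at h
    simpa using h x (Finset.mem_univ x)
  have psum : ∑ x, p x = 1 := by
    have h1 : (Wᴴ * ρ * W).trace = 1 := by
      rw [trace_mul_comm, ← Matrix.mul_assoc, w2, Matrix.one_mul, htr]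
    simp only [trace, diag_apply, hpC] at h1
    exact_mod_cast h1
  have sA (j : ι) : ∑ a, (hA j).eigenvalues a = 1 := by
    simpa [psum] using (margA j fun _ => 1).symm
  have sB : ∑ a, hB.eigenvalues a = 1 := by
    simpa [psum] using (margB fun _ => 1).symm
  refine ⟨W, fun x => (∏ j, (hA j).eigenvalues (x.1 j)) * hB.eigenvalues x.2, w1, w2,
    fun x => mul_nonneg (Finset.prod_nonneg fun j _ => eA0 j _) (eB0 _), ?_, fun x hx => ?_, ?_, ?_⟩
  · rw [Fintype.sum_prod_type]
    simp only [← Finset.mul_sum, sB, mul_one]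
    rw [← Fintype.prod_sum fun j a => (hA j).eigenvalues a]
    simp [sA]
  · rw [hpC, Complex.ofReal_eq_zero]
    rcases mul_eq_zero.mp hx with h | h
    · obtain ⟨j, -, hj⟩ := Finset.prod_eq_zero_iff.mp h
      exact pA x j hj
    · exact pB x h
  · push_cast
    rw [← piKronecker_diagonal (fun j a => ((hA j).eigenvalues a : ℂ))
      (fun a => (hB.eigenvalues a : ℂ)), hW,
      conjTranspose_piKronecker, piKronecker_mul, piKronecker_mul]
    congr 1
    · ext1 j
      exact (hA j).eq_conj_diagonal
    · exact hB.eq_conj_diagonal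
  · have hlog (x) : p x * Real.log ((∏ j, (hA j).eigenvalues (x.1 j)) * hB.eigenvalues x.2) =
        ∑ j, p x * Real.log ((hA j).eigenvalues (x.1 j)) +
          p x * Real.log (hB.eigenvalues x.2) := by
      by_cases hx : p x = 0
      · simp [hx]
      · have h1 (j : ι) : (hA j).eigenvalues (x.1 j) ≠ 0 := fun h => hx (pA x j h)
        have h2 : hB.eigenvalues x.2 ≠ 0 := fun h => hx (pB x h)
        rw [Real.log_mul (Finset.prod_ne_zero_iff.mpr fun j _ => h1 j) h2,
          Real.log_prod fun j _ => h1 j, mul_add, Finset.mul_sum]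
    change ∑ x, p x * Real.log ((∏ j, (hA j).eigenvalues (x.1 j)) * hB.eigenvalues x.2) = _
    simp only [hlog, Finset.sum_add_distrib]
    rw [Finset.sum_comm, margB fun a => Real.log (hB.eigenvalues a),
      Finset.sum_congr rfl fun j _ => margA j fun a => Real.log ((hA j).eigenvalues a)]
    simp only [vnEntropy, dif_pos hB, dif_pos (hA _), Finset.sum_neg_distrib]
    ring

theorem relEnt_piKronecker_marginals {ρ : Matrix ((ι → X) × Y) ((ι → X) × Y) ℂ}
    (hρ : ρ.PosSemidef) (htr : ρ.trace = 1) :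
    relEnt ρ (piKronecker (marginalPi ρ) (marginalLast ρ)) =
      ∑ j, vnEntropy (marginalPi ρ j) + vnEntropy (marginalLast ρ) - vnEntropy ρ := by
  obtain ⟨W, q, w1, w2, -, -, -, hσ, hlog⟩ := exists_productEigenbasis hρ htr
  rw [relEnt, Complex.sub_re, trace_mul_matLog_self hρ.isHermitian, hσ,
    matLog_conj_diagonal W q w1 w2, trace_mul_conj_diagonal, Complex.re_sum]
  simp only [Complex.re_mul_ofReal, hlog]
  ring

/-- Subadditivity of the von Neumann entropy. -/
theorem vnEntropy_le_sum_marginals {ρ : Matrix ((ι → X) × Y) ((ι → X) × Y) ℂ}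
    (hρ : ρ.PosSemidef) (htr : ρ.trace = 1) :
    vnEntropy ρ ≤ ∑ j, vnEntropy (marginalPi ρ j) + vnEntropy (marginalLast ρ) := by
  obtain ⟨W, q, w1, w2, hq, hsum, hsupp, -, hlog⟩ := exists_productEigenbasis hρ htr
  have := trace_mul_matLog_ge hρ W q w1 w2 hq (by rw [hsum, htr]; simp) hsupp
  rw [hlog] at this
  linarith

/-- For a state `ρ = M Mᴴ`, purified by the column index of `M`, the relative entropy to the
product of the marginals is at most twice the sum of all marginal entropies but the last. -/
theorem relEnt_piKronecker_marginals_le {C : Type*} [Fintype C] [DecidableEq C]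
    (M : Matrix ((ι → X) × Y) C ℂ) (htr : (M * Mᴴ).trace = 1) :
    relEnt (M * Mᴴ) (piKronecker (marginalPi (M * Mᴴ)) (marginalLast (M * Mᴴ))) ≤
      2 * ∑ j, vnEntropy (marginalPi (M * Mᴴ) j) := by
  set N : Matrix Y ((ι → X) × C) ℂ := Matrix.of fun y p => M (p.1, y) p.2 with hN
  have hlast : marginalLast (M * Mᴴ) = N * Nᴴ := by
    ext a a'
    simp [marginalLast_apply, Matrix.mul_apply, hN, Fintype.sum_prod_type]
  have hlast' : marginalLast (Nᵀ * Nᵀᴴ) = Mᵀ * Mᵀᴴ := by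
    ext a a'
    simp [marginalLast_apply, Matrix.mul_apply, hN, Fintype.sum_prod_type]
  have hpi (j : ι) : marginalPi (Nᵀ * Nᵀᴴ) j = marginalPi (M * Mᴴ) j := by
    ext a a'
    simp only [marginalPi_apply]
    refine Finset.sum_congr rfl fun f _ => Finset.sum_congr rfl fun f' _ => ?_
    congr 1
    simp only [Matrix.mul_apply, conjTranspose_apply, transpose_apply, hN, Matrix.of_apply]
    exact Finset.sum_comm
  have htr' : (Nᵀ * Nᵀᴴ).trace = 1 := by
    rw [← htr]
    simp only [trace, diag_apply, Matrix.mul_apply, conjTranspose_apply, transpose_apply, hN,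
      Matrix.of_apply, Fintype.sum_prod_type]
    exact Finset.sum_congr rfl fun f _ => Finset.sum_comm
  have h1 := vnEntropy_le_sum_marginals (posSemidef_self_mul_conjTranspose Nᵀ) htr'
  simp only [hpi, hlast', vnEntropy_transpose_mul, ← hlast] at h1
  rw [relEnt_piKronecker_marginals (posSemidef_self_mul_conjTranspose M) htr]
  linarith

end ProductOfMarginals

section ChoiState

/-- Every leg of the process tensor belongs to exactly one step pair or is the leg `o_0`. -/
theorem bijective_keepStep_keepZero (dS k : ℕ) :
    Function.Bijective (fun P : PTIdx dS k => ((fun j => keepStep j P), keepZero P)) := by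
  rw [Fintype.bijective_iff_injective_and_card]
  refine ⟨fun P Q h => ?_, by simp [mul_comm]⟩
  obtain ⟨hstep, hzero⟩ := Prod.mk.inj h
  have hs (j : Fin k) := Prod.mk.inj (congrFun hstep j)
  have hlast : P.1 = Q.1 := by
    rcases Nat.eq_zero_or_pos k with rfl | hk
    · simpa [keepZero] using hzero
    · have := (hs ⟨k - 1, by omega⟩).1
      simpa [show k - 1 + 1 = k by omega] using this
  refine Prod.ext hlast (funext fun m => Prod.ext (hs m).2 ?_)
  rcases Nat.eq_zero_or_pos m with h0 | hm
  · have hk : 0 < k := m.pos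
    simp only [keepZero, dif_pos hk] at hzero
    rwa [show m = ⟨0, hk⟩ from Fin.ext h0]
  · have hlt : (m : ℕ) - 1 + 1 < k := by omega
    have := (hs ⟨m - 1, by omega⟩).1
    simp only [dif_pos hlt] at this
    rwa [show m = ⟨(m : ℕ) - 1 + 1, hlt⟩ from Fin.ext (by simp; omega)]

/-- Regrouping of the legs into step pairs and the initial leg. -/
def legsEquiv (dS k : ℕ) : PTIdx dS k ≃ (Fin k → Fin dS × Fin dS) × Fin dS :=
  Equiv.ofBijective _ (bijective_keepStep_keepZero dS k)

theorem restStep_eq_iff {dS k : ℕ} (j : Fin k) (P Q : PTIdx dS k) :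
    restStep j P = restStep j Q ↔
      (∀ i, i ≠ j → keepStep i P = keepStep i Q) ∧ keepZero P = keepZero Q := by
  constructor
  · intro h
    obtain ⟨h1, h2⟩ := Prod.mk.inj h
    have hi (m : Fin k) := Prod.mk.inj (congrFun h2 m)
    refine ⟨fun i hij => ?_, ?_⟩
    · refine Prod.ext ?_ (by simpa [hij, keepStep] using (hi i).1)
      by_cases hk : (i : ℕ) + 1 < k
      · have := (hi ⟨i + 1, hk⟩).2
        have hne : (i : ℕ) ≠ j := fun h => hij (Fin.ext h)
        simpa [keepStep, hk, hne] using this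
      · have : (j : ℕ) + 1 < k := by
          have hne : (i : ℕ) ≠ j := fun h => hij (Fin.ext h)
          omega
        simpa [keepStep, hk, this] using h1
    · have hk : 0 < k := j.pos
      simpa [keepZero, hk] using (hi ⟨0, hk⟩).2
  · rintro ⟨hs, h0⟩
    refine Prod.ext ?_ (funext fun m => Prod.ext ?_ ?_)
    · by_cases hk : (j : ℕ) + 1 < k
      · have := (Prod.mk.inj (hs ⟨k - 1, by omega⟩ (by
          intro h; have := congrArg Fin.val h; simp at this; omega))).1
        simp [show k - 1 + 1 = k by omega] at this
        simp [restStep, hk, this]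
      · simp [restStep, hk]
    · by_cases hm : m = j
      · simp [restStep, hm]
      · simp [restStep, hm, (Prod.mk.inj (hs m hm)).2]
    · by_cases hm : (m : ℕ) = (j : ℕ) + 1 ∧ (j : ℕ) + 1 < k
      · simp [restStep, hm]
      · simp only [restStep, if_neg hm]
        congr 1
        rcases Nat.eq_zero_or_pos m with hm0 | hm0
        · have hk : 0 < k := m.pos
          simp only [keepZero, dif_pos hk] at h0
          rwa [show m = ⟨0, hk⟩ from Fin.ext hm0]
        · have hlt : (m : ℕ) - 1 + 1 < k := by omega
          have := (Prod.mk.inj (hs ⟨m - 1, by omega⟩ (by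
            intro h; have := congrArg Fin.val h; simp at this; omega))).1
          simp only [dif_pos hlt] at this
          rwa [show m = ⟨(m : ℕ) - 1 + 1, hlt⟩ from Fin.ext (by simp; omega)]

theorem restZero_eq_iff {dS k : ℕ} (P Q : PTIdx dS k) :
    restZero P = restZero Q ↔ ∀ i, keepStep i P = keepStep i Q := by
  constructor
  · intro h i
    obtain ⟨h1, h2⟩ := Prod.mk.inj h
    have hi (m : Fin k) := Prod.mk.inj (congrFun h2 m)
    refine Prod.ext ?_ (hi i).1
    by_cases hk : (i : ℕ) + 1 < k
    · simpa [keepStep, hk] using (hi ⟨i + 1, hk⟩).2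
    · simpa [keepStep, hk, i.pos] using h1
  · intro hs
    refine Prod.ext ?_ (funext fun m => Prod.ext (Prod.mk.inj (hs m)).2 ?_)
    · rcases Nat.eq_zero_or_pos k with rfl | hk
      · simp [restZero]
      · have := (Prod.mk.inj (hs ⟨k - 1, by omega⟩)).1
        simp [show k - 1 + 1 = k by omega] at this
        simp [restZero, this]
    · rcases Nat.eq_zero_or_pos m with hm | hm
      · simp [restZero, hm]
      · have hlt : (m : ℕ) - 1 + 1 < k := by omega
        have := (Prod.mk.inj (hs ⟨m - 1, by omega⟩)).1
        simp only [dif_pos hlt] at this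
        simp only [restZero, if_neg hm.ne']
        congr 1
        rwa [show m = ⟨(m : ℕ) - 1 + 1, hlt⟩ from Fin.ext (by simp; omega)]

theorem Ehat_eq_marginalPi (dS dE : ℕ) (ρ0 : Matrix (Fin dS × Fin dE) (Fin dS × Fin dE) ℂ)
    (U : ℕ → Matrix (Fin dS × Fin dE) (Fin dS × Fin dE) ℂ) (k : ℕ) (j : Fin k) :
    Ehat dS dE ρ0 U k j = marginalPi ((ChoiPT dS dE ρ0 U k).submatrix
      (legsEquiv dS k).symm (legsEquiv dS k).symm) j := by
  ext a a'
  simp only [Ehat, marginal, marginalPi, Matrix.of_apply, submatrix_apply]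
  rw [← (legsEquiv dS k).sum_comp]
  refine Finset.sum_congr rfl fun P _ => ?_
  rw [← (legsEquiv dS k).sum_comp]
  refine Finset.sum_congr rfl fun Q _ => ?_
  simp only [restStep_eq_iff, Equiv.symm_apply_apply]
  rfl

theorem rho0hat_eq_marginalLast (dS dE : ℕ)
    (ρ0 : Matrix (Fin dS × Fin dE) (Fin dS × Fin dE) ℂ)
    (U : ℕ → Matrix (Fin dS × Fin dE) (Fin dS × Fin dE) ℂ) (k : ℕ) :
    rho0hat dS dE ρ0 U k = marginalLast ((ChoiPT dS dE ρ0 U k).submatrix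
      (legsEquiv dS k).symm (legsEquiv dS k).symm) := by
  ext a a'
  simp only [rho0hat, marginal, marginalLast, Matrix.of_apply, submatrix_apply]
  rw [← (legsEquiv dS k).sum_comp]
  refine Finset.sum_congr rfl fun P _ => ?_
  rw [← (legsEquiv dS k).sum_comp]
  refine Finset.sum_congr rfl fun Q _ => ?_
  simp only [restZero_eq_iff, Equiv.symm_apply_apply]
  rfl

theorem markovProduct_submatrix (dS dE : ℕ)
    (ρ0 : Matrix (Fin dS × Fin dE) (Fin dS × Fin dE) ℂ)
    (U : ℕ → Matrix (Fin dS × Fin dE) (Fin dS × Fin dE) ℂ) (k : ℕ) :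
    (markovProduct dS dE ρ0 U k).submatrix (legsEquiv dS k).symm (legsEquiv dS k).symm =
      piKronecker (Ehat dS dE ρ0 U k) (rho0hat dS dE ρ0 U k) := by
  ext P Q
  obtain ⟨P, rfl⟩ := (legsEquiv dS k).surjective P
  obtain ⟨Q, rfl⟩ := (legsEquiv dS k).surjective Q
  rw [submatrix_apply, Equiv.symm_apply_apply, Equiv.symm_apply_apply]
  rfl

theorem sum_norm_sq_mulVec {n : Type*} [Fintype n] [DecidableEq n] {U : Matrix n n ℂ}
    (hU : U ∈ unitaryGroup n ℂ) (v : n → ℂ) :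
    ∑ x, ‖(U *ᵥ v) x‖ ^ 2 = ∑ x, ‖v x‖ ^ 2 := by
  have h (w : n → ℂ) : ((∑ x, ‖w x‖ ^ 2 : ℝ) : ℂ) = star w ⬝ᵥ w := by
    simp [dotProduct, Complex.conj_mul']
  apply Complex.ofReal_injective
  rw [h, h, star_mulVec, ← dotProduct_mulVec, mulVec_mulVec, ← star_eq_conjTranspose,
    mem_unitaryGroup_iff'.mp hU, one_mulVec]

/-- The environment-open process tensor built from a pure state and unitaries is pure. -/
theorem exists_UpsE_eq_pure {dS dE : ℕ} (hdS : 0 < dS) (ψ0 : Fin dS × Fin dE → ℂ)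
    (hψ0 : ∑ x : Fin dS × Fin dE, ‖ψ0 x‖ ^ 2 = 1)
    (U : ℕ → Matrix (Fin dS × Fin dE) (Fin dS × Fin dE) ℂ) (k : ℕ)
    (hU : ∀ j < k, U j ∈ Matrix.unitaryGroup (Fin dS × Fin dE) ℂ) :
    ∃ φ : (Fin dS × Fin dE) × (Fin k → Fin dS × Fin dS) → ℂ,
      (∀ P Q, UpsE dS dE (Matrix.of fun p q => ψ0 p * (starRingEnd ℂ) (ψ0 q)) U k P Q =
        φ P * (starRingEnd ℂ) (φ Q)) ∧ ∑ P, ‖φ P‖ ^ 2 = 1 := by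
  induction k with
  | zero =>
    refine ⟨fun P => ψ0 P.1, fun P Q => rfl, ?_⟩
    rw [Fintype.sum_prod_type]
    simpa using hψ0
  | succ k ih =>
    obtain ⟨φ, hφ, hsum⟩ := ih fun j hj => hU j (hj.trans k.lt_succ_self)
    have hd : (0 : ℝ) < dS := by exact_mod_cast hdS
    set c : ℂ := ((Real.sqrt dS : ℝ) : ℂ)⁻¹ with hc
    have hcc : c * (starRingEnd ℂ) c = (dS : ℂ)⁻¹ := by
      rw [hc, map_inv₀, Complex.conj_ofReal, ← mul_inv, ← Complex.ofReal_mul,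
        Real.mul_self_sqrt hd.le, Complex.ofReal_natCast]
    have hcn : ‖c‖ ^ 2 = (dS : ℝ)⁻¹ := by
      rw [hc, norm_inv, Complex.norm_real, Real.norm_eq_abs, inv_pow, sq_abs, Real.sq_sqrt hd.le]
    refine ⟨fun P => c * ∑ ε, U k P.1 ((P.2 (Fin.last k)).1, ε) *
      φ (((P.2 (Fin.last k)).2, ε), fun m => P.2 m.castSucc), fun P Q => ?_, ?_⟩
    · simp only [UpsE, Matrix.of_apply, hφ, map_mul, map_sum]
      rw [mul_mul_mul_comm, hcc, Finset.sum_mul_sum]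
      congr 1
      refine Finset.sum_congr rfl fun ε _ => Finset.sum_congr rfl fun ε' _ => by ring
    · have hcol (i o : Fin dS) (f : Fin k → Fin dS × Fin dS) :
          ∑ x, ‖∑ ε, U k x (i, ε) * φ ((o, ε), f)‖ ^ 2 = ∑ ε, ‖φ ((o, ε), f)‖ ^ 2 := by
        have := sum_norm_sq_mulVec (hU k k.lt_succ_self)
          (fun y => if y.1 = i then φ ((o, y.2), f) else 0)
        simp only [mulVec, dotProduct, Fintype.sum_prod_type (γ := ℂ), mul_ite, mul_zero,
          Finset.sum_ite_irrel, Finset.sum_const_zero, Finset.sum_ite_eq', Finset.mem_univ,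
          if_true] at this
        rw [this, Fintype.sum_prod_type]
        simp [apply_ite norm, ite_pow, Finset.sum_ite_irrel]
      rw [Fintype.sum_prod_type_right, ← (Fin.snocEquiv fun _ => Fin dS × Fin dS).sum_comp,
        Fintype.sum_prod_type]
      simp only [norm_mul, mul_pow, hcn, Fin.snocEquiv_apply, Fin.snoc_last, Fin.snoc_castSucc,
        ← Finset.mul_sum, hcol]
      rw [Fintype.sum_prod_type]
      simp only [Finset.sum_const, Finset.card_univ, Fintype.card_fin, nsmul_eq_mul]
      rw [inv_mul_cancel_left₀ hd.ne', Finset.sum_comm, ← hsum, Fintype.sum_prod_type_right]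
      exact Finset.sum_congr rfl fun f _ => (Fintype.sum_prod_type fun x => ‖φ (x, f)‖ ^ 2).symm

end ChoiState

/-- **Non-Markovianity is bounded by the entropies of the step marginals.**  For a `k`-step
process tensor built from a pure initial state and unitaries, the relative-entropy
non-Markovianity measure is at most twice the sum of the von Neumann entropies of the
single-step marginals. -/
theorem nonMarkovianity_le_sum_entropies
    (dS dE : ℕ) (hdS : 2 ≤ dS) (hdE : 2 ≤ dE) (k : ℕ)
    (ψ0 : Fin dS × Fin dE → ℂ) (hψ0 : ∑ x : Fin dS × Fin dE, ‖ψ0 x‖ ^ 2 = 1)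
    (U : ℕ → Matrix (Fin dS × Fin dE) (Fin dS × Fin dE) ℂ)
    (hU : ∀ j < k, U j ∈ Matrix.unitaryGroup (Fin dS × Fin dE) ℂ) :
    relEnt
        (ChoiPT dS dE (Matrix.of fun p q => ψ0 p * (starRingEnd ℂ) (ψ0 q)) U k)
        (markovProduct dS dE (Matrix.of fun p q => ψ0 p * (starRingEnd ℂ) (ψ0 q)) U k) ≤
      2 * ∑ j : Fin k,
        vnEntropy (Ehat dS dE (Matrix.of fun p q => ψ0 p * (starRingEnd ℂ) (ψ0 q)) U k j) := by
  obtain ⟨φ, hφ, hsum⟩ := exists_UpsE_eq_pure (by omega) ψ0 hψ0 U k hU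
  set ρ0 : Matrix (Fin dS × Fin dE) (Fin dS × Fin dE) ℂ :=
    Matrix.of fun p q => ψ0 p * (starRingEnd ℂ) (ψ0 q)
  set e := (legsEquiv dS k).symm with he
  set M : Matrix ((Fin k → Fin dS × Fin dS) × Fin dS) (Fin dE) ℂ :=
    Matrix.of fun P ε => φ (((e P).1, ε), (e P).2) with hM
  have hρ : (ChoiPT dS dE ρ0 U k).submatrix e e = M * Mᴴ := by
    ext P Q
    simp [ChoiPT, Matrix.mul_apply, hM, hφ]
  have htr : (M * Mᴴ).trace = 1 := by
    have h1 : ∑ P, ∑ ε, ‖M P ε‖ ^ 2 = 1 := by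
      simp only [hM, Matrix.of_apply]
      rw [← hsum, e.sum_comp fun P => ∑ ε, ‖φ ((P.1, ε), P.2)‖ ^ 2]
      simp only [Fintype.sum_prod_type]
      exact Finset.sum_congr rfl fun s _ => Finset.sum_comm
    have h2 : (M * Mᴴ).trace = ((∑ P, ∑ ε, ‖M P ε‖ ^ 2 : ℝ) : ℂ) := by
      simp [trace, Matrix.mul_apply, Complex.mul_conj']
    rw [h2, h1, Complex.ofReal_one]
  have hE : Ehat dS dE ρ0 U k = marginalPi (M * Mᴴ) :=
    funext fun j => by rw [Ehat_eq_marginalPi, ← he, hρ]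
  rw [← relEnt_submatrix e, markovProduct_submatrix, rho0hat_eq_marginalLast, ← he, hρ, hE]
  exact relEnt_piKronecker_marginals_le M htr
end
end
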